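/- arXiv:2201.00765 — 2 statements merged into one kernel-verified Lean document; each statement's English description precedes it below -/
import Mathlib

section
/- Let $s\in(0,2)$. The function $G_s(r)=\int_0^\infty \lambda^{s/2-1}e^{-\lambda-r^2/(4\lambda)}\,d\lambda$ is differentiable on $(0,\infty)$ with $G_s'(r)=-\tfrac{r}{2}\int_0^\infty \lambda^{s/2-2}e^{-\lambda-r^2/(4\lambda)}\,d\lambda$, and for every $a>1-2s$ one has $\int_0^\infty G_s'(r)^2\,r^{a}\,dr<\infty$. -/
open MeasureTheory Real Set
open scoped ENNReal

noncomputable section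

/-- `G_s(r) = ∫_0^∞ λ^{s/2-1} e^{-λ - r²/(4λ)} dλ`. -/
def Gfun (s r : ℝ) : ℝ :=
  ∫ l in Set.Ioi (0:ℝ), l ^ (s/2 - 1) * Real.exp (-l - r^2 / (4*l))

/-- `G_s'(r) = -(r/2) ∫_0^∞ λ^{s/2-2} e^{-λ - r²/(4λ)} dλ`. -/
def Gfun' (s r : ℝ) : ℝ :=
  -(r/2) * ∫ l in Set.Ioi (0:ℝ), l ^ (s/2 - 2) * Real.exp (-l - r^2 / (4*l))

/-- The substitution `l ↦ l⁻¹` in the integrand of the Gamma integral. -/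
lemma comp_rpow_neg_one_gamma_integrand (q b : ℝ) {l : ℝ} (hl : 0 < l) :
    (|(-1 : ℝ)| * l ^ ((-1 : ℝ) - 1)) •
        ((l ^ (-1 : ℝ)) ^ (q - 1) * Real.exp (-(b * l ^ (-1 : ℝ)))) =
      l ^ (-q - 1) * Real.exp (-(b / l)) := by
  rw [← Real.rpow_mul hl.le, abs_neg, abs_one, one_mul, smul_eq_mul, ← mul_assoc,
    ← Real.rpow_add hl, Real.rpow_neg_one, div_eq_mul_inv]
  ring_nf

lemma integrableOn_rpow_mul_exp_neg_div {q b : ℝ} (hq : 0 < q) (hb : 0 < b) :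
    IntegrableOn (fun l : ℝ => l ^ (-q - 1) * Real.exp (-(b / l))) (Ioi 0) := by
  have h : IntegrableOn (fun t : ℝ => t ^ (q - 1) * Real.exp (-(b * t))) (Ioi 0) := by
    simpa using integrableOn_rpow_mul_exp_neg_mul_rpow (p := 1) (s := q - 1) (b := b)
      (by linarith) one_pos hb
  refine ((integrableOn_Ioi_comp_rpow_iff _ (by norm_num : (-1 : ℝ) ≠ 0)).2 h).congr_fun
    (fun l hl => ?_) measurableSet_Ioi
  exact comp_rpow_neg_one_gamma_integrand q b hl

lemma integral_rpow_mul_exp_neg_div {q b : ℝ} (hq : 0 < q) (hb : 0 < b) :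
    ∫ l in Ioi (0 : ℝ), l ^ (-q - 1) * Real.exp (-(b / l)) = (1 / b) ^ q * Real.Gamma q := by
  rw [← Real.integral_rpow_mul_exp_neg_mul_Ioi hq hb,
    ← integral_comp_rpow_Ioi (fun t => t ^ (q - 1) * Real.exp (-(b * t)))
      (by norm_num : (-1 : ℝ) ≠ 0)]
  exact setIntegral_congr_fun measurableSet_Ioi fun l hl =>
    (comp_rpow_neg_one_gamma_integrand q b hl).symm

lemma aestronglyMeasurable_rpow_mul_exp (p r : ℝ) (μ : Measure ℝ) :
    AEStronglyMeasurable (fun l : ℝ => l ^ p * Real.exp (-l - r ^ 2 / (4 * l))) μ :=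
  Measurable.aestronglyMeasurable (by fun_prop)

lemma measurable_Gfun' (s : ℝ) : Measurable (Gfun' s) := by
  unfold Gfun'
  refine Measurable.mul (by fun_prop) ?_
  refine (StronglyMeasurable.integral_prod_right (f := fun r l : ℝ =>
    l ^ (s / 2 - 2) * Real.exp (-l - r ^ 2 / (4 * l))) ?_).measurable
  exact Measurable.stronglyMeasurable (by unfold Function.uncurry; fun_prop)

lemma integrableOn_Gfun_integrand {s : ℝ} (hs : 0 < s) (r : ℝ) :
    IntegrableOn (fun l : ℝ => l ^ (s / 2 - 1) * Real.exp (-l - r ^ 2 / (4 * l))) (Ioi 0) := by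
  refine (Real.GammaIntegral_convergent (half_pos hs)).mono'
    (aestronglyMeasurable_rpow_mul_exp _ _ _) ?_
  filter_upwards [ae_restrict_mem measurableSet_Ioi] with l hl
  have hl : 0 < l := hl
  rw [Real.norm_of_nonneg (by positivity), mul_comm]
  gcongr
  have : 0 ≤ r ^ 2 / (4 * l) := by positivity
  linarith

lemma Gfun_hasDerivAt {s r : ℝ} (hs : s ∈ Ioo (0 : ℝ) 2) (hr : 0 < r) :
    HasDerivAt (Gfun s) (Gfun' s r) r := by
  have hq : 0 < 1 - s / 2 := by linarith [hs.2]
  have key := hasDerivAt_integral_of_dominated_loc_of_deriv_le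
    (μ := volume.restrict (Ioi (0 : ℝ))) (x₀ := r) (s := Ioo (r / 2) (2 * r))
    (F := fun x l => l ^ (s / 2 - 1) * Real.exp (-l - x ^ 2 / (4 * l)))
    (F' := fun x l => -(x / 2) * (l ^ (s / 2 - 2) * Real.exp (-l - x ^ 2 / (4 * l))))
    (bound := fun l => r * (l ^ (-(1 - s / 2) - 1) * Real.exp (-((r / 2) ^ 2 / 4 / l))))
    (Ioo_mem_nhds (by linarith) (by linarith))
    (Filter.Eventually.of_forall fun x => aestronglyMeasurable_rpow_mul_exp _ _ _)
    (integrableOn_Gfun_integrand hs.1 r)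
    ((aestronglyMeasurable_rpow_mul_exp _ _ _).const_mul _) ?_
    ((integrableOn_rpow_mul_exp_neg_div hq (by positivity)).const_mul r) ?_
  · have h := key.2
    rwa [integral_const_mul] at h
  · filter_upwards [ae_restrict_mem measurableSet_Ioi] with l hl x hx
    have hl : 0 < l := hl
    have hx0 : 0 < x := by linarith [hx.1]
    rw [norm_mul, norm_neg, Real.norm_of_nonneg (by positivity : 0 ≤ x / 2),
      Real.norm_of_nonneg (by positivity),
      show -(1 - s / 2) - 1 = s / 2 - 2 by ring]
    have h1 : (r / 2) ^ 2 / 4 / l ≤ x ^ 2 / (4 * l) := by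
      rw [div_div]
      gcongr
      exact hx.1.le
    gcongr
    · linarith [hx.2]
    · linarith
  · filter_upwards [ae_restrict_mem measurableSet_Ioi] with l hl x _
    have hl : 0 < l := hl
    have h := ((((hasDerivAt_pow 2 x).div_const (4 * l)).const_sub (-l)).exp).const_mul
      (l ^ (s / 2 - 1))
    refine h.congr_deriv ?_
    rw [show s / 2 - 1 = (s / 2 - 2) + 1 by ring, Real.rpow_add_one hl.ne']
    field_simp
    push_cast
    ring

/-- By the AM-GM inequality `l + r² / (4 l) ≥ r`, half of the exponent already decays in `r`. -/
lemma neg_sub_sq_div_le {l r : ℝ} (hl : 0 < l) :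
    -l - r ^ 2 / (4 * l) ≤ -(r / 2) + -(r ^ 2 / 8 / l) := by
  have h : l + r ^ 2 / (4 * l) - (r / 2 + r ^ 2 / 8 / l) = ((l - r / 4) ^ 2 +
      (r / 4) ^ 2) / l := by
    field_simp
    ring
  have : 0 ≤ ((l - r / 4) ^ 2 + (r / 4) ^ 2) / l := by positivity
  linarith

lemma integral_rpow_mul_exp_le {s r : ℝ} (hs : s < 2) (hr : 0 < r) :
    ∫ l in Ioi (0 : ℝ), l ^ (s / 2 - 2) * Real.exp (-l - r ^ 2 / (4 * l)) ≤
      Real.exp (-(r / 2)) * ((1 / (r ^ 2 / 8)) ^ (1 - s / 2) * Real.Gamma (1 - s / 2)) := by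
  have hq : 0 < 1 - s / 2 := by linarith
  have hb : 0 < r ^ 2 / 8 := by positivity
  rw [← integral_rpow_mul_exp_neg_div hq hb, ← integral_const_mul]
  refine integral_mono_of_nonneg ?_ ((integrableOn_rpow_mul_exp_neg_div hq hb).const_mul _) ?_
  · filter_upwards [ae_restrict_mem measurableSet_Ioi] with l hl
    have hl : 0 < l := hl
    exact mul_nonneg (by positivity) (by positivity)
  · filter_upwards [ae_restrict_mem measurableSet_Ioi] with l hl
    have hl : 0 < l := hl
    rw [mul_left_comm, ← Real.exp_add, show -(1 - s / 2) - 1 = s / 2 - 2 by ring]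
    gcongr
    exact neg_sub_sq_div_le hl

lemma abs_Gfun'_le {s r : ℝ} (hs : s < 2) (hr : 0 < r) :
    |Gfun' s r| ≤
      8 ^ (1 - s / 2) * Real.Gamma (1 - s / 2) / 2 * (r ^ (s - 1) * Real.exp (-(r / 2))) := by
  have h0 : 0 ≤ ∫ l in Ioi (0 : ℝ), l ^ (s / 2 - 2) * Real.exp (-l - r ^ 2 / (4 * l)) :=
    setIntegral_nonneg measurableSet_Ioi fun l (hl : 0 < l) => by positivity
  have hpow : (1 / (r ^ 2 / 8)) ^ (1 - s / 2) = 8 ^ (1 - s / 2) * r ^ (s - 2) := by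
    rw [one_div_div, Real.div_rpow (by norm_num) (by positivity), ← Real.rpow_natCast,
      ← Real.rpow_mul hr.le, div_eq_mul_inv, ← Real.rpow_neg hr.le]
    congr 2
    push_cast
    ring
  rw [Gfun', abs_mul, abs_neg, abs_of_pos (half_pos hr), abs_of_nonneg h0]
  calc _ ≤ r / 2 * (Real.exp (-(r / 2)) *
        ((1 / (r ^ 2 / 8)) ^ (1 - s / 2) * Real.Gamma (1 - s / 2))) := by
        gcongr
        exact integral_rpow_mul_exp_le hs hr
    _ = _ := by
        rw [hpow, show s - 1 = (s - 2) + 1 by ring, Real.rpow_add_one hr.ne']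
        ring

lemma integrableOn_Gfun'_sq_mul_rpow {s a : ℝ} (hs : s < 2) (ha : 1 - 2 * s < a) :
    IntegrableOn (fun r : ℝ => (Gfun' s r) ^ 2 * r ^ a) (Ioi 0) := by
  have hint := (Real.GammaIntegral_convergent (s := 2 * s - 1 + a) (by linarith)).const_mul
    ((8 ^ (1 - s / 2) * Real.Gamma (1 - s / 2) / 2) ^ 2)
  refine hint.mono' (((measurable_Gfun' s).pow_const 2).mul
    (by fun_prop)).aestronglyMeasurable ?_
  filter_upwards [ae_restrict_mem measurableSet_Ioi] with r hr
  have hr : 0 < r := hr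
  rw [Real.norm_of_nonneg (by positivity), ← sq_abs]
  calc _ ≤ (8 ^ (1 - s / 2) * Real.Gamma (1 - s / 2) / 2 *
        (r ^ (s - 1) * Real.exp (-(r / 2)))) ^ 2 * r ^ a := by
        gcongr
        exact abs_Gfun'_le hs hr
    _ = _ := by
        rw [show 2 * s - 1 + a - 1 = (s - 1) + (s - 1) + a by ring, Real.rpow_add hr,
          Real.rpow_add hr, show -r = -(r / 2) + -(r / 2) by ring, Real.exp_add]
        ring

/-- `G_s` is differentiable on `(0,∞)` with derivative `G_s'`, and for every
`a > 1 - 2s` one has `∫_0^∞ G_s'(r)² r^a dr < ∞`. -/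
theorem Gfun_hasDerivAt_and_deriv_sq_integrable (s : ℝ) (hs : s ∈ Set.Ioo (0:ℝ) 2) :
    (∀ r ∈ Set.Ioi (0:ℝ), HasDerivAt (Gfun s) (Gfun' s r) r) ∧
    (∀ a : ℝ, 1 - 2*s < a →
      IntegrableOn (fun r : ℝ => (Gfun' s r)^2 * r ^ a) (Set.Ioi (0:ℝ))) := by
  exact ⟨fun r hr => Gfun_hasDerivAt hs hr, fun a ha => integrableOn_Gfun'_sq_mul_rpow hs.2 ha⟩

end
end

section
/- Let $n\ge1$, $s\in(0,2)$ and $\beta\in(0,\min\{n,2s\})$. There exists a constant $C>0$ depending only on $n,s,\beta$ such that for every $f\in C_0^\infty(\mathbb{R}^n)$ with Caffarelli–Silvestre extension $u(x,t)=(p_t^s*f)(x)$, the following three inequalities hold: (i) $\big(\int_{\mathbb{R}^n}|f(x)|^{2n/(n-\beta)}dx\big)^{(n-\beta)/n}\le C\int_0^\infty\!\int_{\mathbb{R}^n}|\partial_t u(x,t)|^2 t^{1-\beta}\,dx\,dt$; (ii) if moreover $\int_{\mathbb{R}^n}|f(x)|^2dx=1$, then $\exp\big(\frac{\beta}{n}\int_{\mathbb{R}^n}|f(x)|^2\ln(|f(x)|^2)dx\big)\le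 C\int_0^\infty\!\int_{\mathbb{R}^n}|\partial_t u(x,t)|^2 t^{1-\beta}\,dx\,dt$; (iii) $\int_{\mathbb{R}^n}\frac{|f(x)|^2}{|x|^{\beta}}dx\le C\int_0^\infty\!\int_{\mathbb{R}^n}|\partial_t u(x,t)|^2 t^{1-\beta}\,dx\,dt$. -/
open MeasureTheory Real Set Metric
open scoped ENNReal

noncomputable section

/-- The normalizing constant `c(n,s) = Γ((n+s)/2)/(π^{n/2} Γ(s/2))`. -/
def cns (n : ℕ) (s : ℝ) : ℝ :=
  Real.Gamma (((n:ℝ) + s)/2) / (Real.pi ^ ((n:ℝ)/2) * Real.Gamma (s/2))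

/-- The fractional Poisson kernel `p_t^s(x) = c(n,s) t^s (|x|² + t²)^{-(n+s)/2}`. -/
def pker (n : ℕ) (s t : ℝ) (x : EuclideanSpace ℝ (Fin n)) : ℝ :=
  cns n s * t ^ s * (‖x‖^2 + t^2) ^ (-((n:ℝ) + s)/2)

/-- The Caffarelli–Silvestre extension `u(x,t) = (p_t^s * f)(x)`. -/
def csExt (n : ℕ) (s : ℝ) (f : EuclideanSpace ℝ (Fin n) → ℝ)
    (x : EuclideanSpace ℝ (Fin n)) (t : ℝ) : ℝ :=
  ∫ y, pker n s t (x - y) * f y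

/-- The anisotropic energy `∫∫_{ℝ^{n+1}_+} |∂_t u(x,t)|² t^{1-β} dx dt`. -/
def tEnergy (n : ℕ) (s β : ℝ) (f : EuclideanSpace ℝ (Fin n) → ℝ) : ℝ :=
  ∫ z in {z : EuclideanSpace ℝ (Fin n) × ℝ | 0 < z.2},
    (deriv (fun τ : ℝ => csExt n s f z.1 τ) z.2)^2 * z.2 ^ (1 - β)

section

open Filter Topology

/-- The Gaussian density `(πa)^{-n/2} e^{-|x|²/a}`. -/
def gaussKer (n : ℕ) (a : ℝ) (x : EuclideanSpace ℝ (Fin n)) : ℝ :=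
  (π * a) ^ (-(n:ℝ)/2) * rexp (-(‖x‖^2 / a))

lemma gaussKer_nonneg {n : ℕ} {a : ℝ} (ha : 0 ≤ a) (x : EuclideanSpace ℝ (Fin n)) :
    0 ≤ gaussKer n a x := by
  unfold gaussKer; positivity

lemma gaussKer_le {n : ℕ} {a : ℝ} (ha : 0 < a) (x : EuclideanSpace ℝ (Fin n)) :
    gaussKer n a x ≤ (π * a) ^ (-(n:ℝ)/2) := by
  unfold gaussKer
  refine mul_le_of_le_one_right (by positivity) ?_
  rw [Real.exp_le_one_iff]
  have : 0 ≤ ‖x‖^2 / a := by positivity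
  linarith

lemma measurable_gaussKer (n : ℕ) :
    Measurable (fun p : ℝ × EuclideanSpace ℝ (Fin n) => gaussKer n p.1 p.2) := by
  unfold gaussKer; fun_prop

lemma continuous_gaussKer (n : ℕ) (a : ℝ) : Continuous (gaussKer n a) := by
  unfold gaussKer; fun_prop

lemma integral_gaussKer {n : ℕ} {a : ℝ} (ha : 0 < a) : ∫ x, gaussKer n a x = 1 := by
  unfold gaussKer
  rw [integral_const_mul]
  have h := GaussianFourier.integral_rexp_neg_mul_sq_norm
    (V := EuclideanSpace ℝ (Fin n)) (b := 1/a) (by positivity)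
  have e : ∀ x : EuclideanSpace ℝ (Fin n), -(‖x‖^2/a) = -(1/a) * ‖x‖^2 := fun x => by ring
  simp_rw [e, h]
  rw [finrank_euclideanSpace_fin, div_div_eq_mul_div, div_one, neg_div, Real.rpow_neg
      (by positivity)]
  exact inv_mul_cancel₀ (by positivity)

lemma integrable_gaussKer {n : ℕ} {a : ℝ} (ha : 0 < a) : Integrable (gaussKer n a) := by
  by_contra h
  have := integral_gaussKer (n := n) ha
  rw [integral_undef h] at this
  exact zero_ne_one this

lemma gaussKer_mul_gaussKer {n : ℕ} {a b : ℝ} (ha : 0 < a) (hb : 0 < b)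
    (x y z : EuclideanSpace ℝ (Fin n)) :
    gaussKer n a (y - z) * gaussKer n b (x - y) =
      gaussKer n (a + b) (x - z) *
        gaussKer n (a * b / (a + b)) (y - ((b/(a+b)) • z + (a/(a+b)) • x)) := by
  unfold gaussKer
  have hab : a + b ≠ 0 := by positivity
  have e1 : ‖y - z‖^2/a + ‖x - y‖^2/b = ‖x - z‖^2/(a+b) +
      ‖y - ((b/(a+b)) • z + (a/(a+b)) • x)‖^2/(a*b/(a+b)) := by
    have e : y - ((b/(a+b)) • z + (a/(a+b)) • x) = (b/(a+b)) • (y - z) - (a/(a+b)) • (x - y) := by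
      have : y = (b/(a+b)) • y + (a/(a+b)) • y := by
        rw [← add_smul, ← add_div, add_comm b a, div_self hab, one_smul]
      nth_rewrite 1 [this]
      module
    have e' : x - z = (y - z) + (x - y) := by abel
    rw [e, e', norm_sub_sq_real ((b/(a+b)) • (y - z)), norm_add_sq_real, norm_smul, norm_smul,
        inner_smul_left,
      inner_smul_right, Real.norm_of_nonneg (by positivity), Real.norm_of_nonneg (by positivity)]
    simp only [RCLike.conj_to_real]
    field_simp
    ring
  have e2 : (π * a) ^ (-(n:ℝ)/2) * (π * b) ^ (-(n:ℝ)/2) =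
      (π * (a + b)) ^ (-(n:ℝ)/2) * (π * (a*b/(a+b))) ^ (-(n:ℝ)/2) := by
    rw [← Real.mul_rpow (by positivity) (by positivity), ← Real.mul_rpow (by positivity)
        (by positivity)]
    congr 1
    field_simp
  rw [mul_mul_mul_comm, e2, 
    mul_mul_mul_comm _ (rexp (-(‖x - z‖^2/(a+b)))), ← Real.exp_add,
    ← Real.exp_add, ← neg_add, ← neg_add, e1]

lemma integral_gaussKer_mul_gaussKer {n : ℕ} {a b : ℝ} (ha : 0 < a) (hb : 0 < b)
    (x z : EuclideanSpace ℝ (Fin n)) :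
    ∫ y, gaussKer n a (y - z) * gaussKer n b (x - y) = gaussKer n (a + b) (x - z) := by
  simp_rw [gaussKer_mul_gaussKer ha hb x _ z]
  rw [integral_const_mul, integral_sub_right_eq_self (gaussKer n (a*b/(a+b))), integral_gaussKer
      (by positivity), mul_one]

/-- The derivative of `gaussKer` in its parameter. -/
def gaussKerDeriv (n : ℕ) (a : ℝ) (x : EuclideanSpace ℝ (Fin n)) : ℝ :=
  gaussKer n a x * ((-(n:ℝ)/2 + ‖x‖^2 / a) / a)

lemma hasDerivAt_gaussKer {n : ℕ} {a : ℝ} (ha : 0 < a) (x : EuclideanSpace ℝ (Fin n)) :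
    HasDerivAt (fun a => gaussKer n a x) (gaussKerDeriv n a x) a := by
  unfold gaussKerDeriv gaussKer
  have h1 : HasDerivAt (fun a : ℝ => (π * a) ^ (-(n:ℝ)/2))
      (π * (-(n:ℝ)/2) * (π * a) ^ (-(n:ℝ)/2 - 1)) a := by
    have := ((hasDerivAt_id a).const_mul π).rpow_const (p := -(n:ℝ)/2)
        (Or.inl (by simp; positivity))
    simpa using this
  have h2 : HasDerivAt (fun a : ℝ => rexp (-(‖x‖^2 / a)))
      (rexp (-(‖x‖^2 / a)) * (‖x‖^2 / a^2)) a := by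
    have := (((hasDerivAt_inv ha.ne').const_mul (‖x‖^2)).neg).exp
    simpa [div_eq_mul_inv] using this
  refine (h1.mul h2).congr_deriv ?_
  rw [Real.rpow_sub_one (by positivity)]
  field_simp

lemma abs_gaussKerDeriv_le {n : ℕ} {a : ℝ} (ha : 0 < a) (x : EuclideanSpace ℝ (Fin n)) :
    |gaussKerDeriv n a x| ≤ (π * a) ^ (-(n:ℝ)/2) * (((n:ℝ)/2 + 1) / a) := by
  unfold gaussKerDeriv gaussKer
  set y := ‖x‖^2 / a with hy
  have hy0 : 0 ≤ y := by positivity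
  have h1 : y * rexp (-y) ≤ 1 := by
    rw [Real.exp_neg, ← div_eq_mul_inv, div_le_one (Real.exp_pos _)]
    linarith [Real.add_one_le_exp y]
  have h2 : rexp (-y) ≤ 1 := by rw [Real.exp_le_one_iff]; linarith
  rw [abs_mul, abs_mul, abs_of_nonneg (by positivity : 0 ≤ (π * a) ^ (-(n:ℝ)/2)),
    abs_of_pos (Real.exp_pos _), mul_assoc]
  refine mul_le_mul_of_nonneg_left ?_ (by positivity)
  rw [abs_div, abs_of_pos ha, mul_div_assoc']
  refine div_le_div_of_nonneg_right ?_ ha.le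
  have h3 : |-(n:ℝ)/2 + y| ≤ (n:ℝ)/2 + y := by
    rw [abs_le]; constructor <;> linarith [(Nat.cast_nonneg n : (0:ℝ) ≤ n)]
  calc rexp (-y) * |-(n:ℝ)/2 + y| ≤ rexp (-y) * ((n:ℝ)/2 + y) := by gcongr
    _ = rexp (-y) * ((n:ℝ)/2) + y * rexp (-y) := by ring
    _ ≤ 1 * ((n:ℝ)/2) + 1 := by gcongr
    _ = _ := by ring

end

section

open Filter Topology

/-- The heat extension `(gaussKer n a * f)(x)`. -/
def heatExt (n : ℕ) (f : EuclideanSpace ℝ (Fin n) → ℝ) (x : EuclideanSpace ℝ (Fin n)) (a : ℝ) : ℝ :=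
  ∫ z, gaussKer n a (x - z) * f z

/-- The derivative of `heatExt` in its parameter. -/
def heatExtDeriv (n : ℕ) (f : EuclideanSpace ℝ (Fin n) → ℝ) (x : EuclideanSpace ℝ (Fin n))
    (a : ℝ) : ℝ :=
  ∫ z, gaussKerDeriv n a (x - z) * f z

lemma measurable_gaussKerDeriv (n : ℕ) :
    Measurable (fun p : ℝ × EuclideanSpace ℝ (Fin n) => gaussKerDeriv n p.1 p.2) := by
  unfold gaussKerDeriv
  have := measurable_gaussKer n
  fun_prop

section
variable {n : ℕ} {f : EuclideanSpace ℝ (Fin n) → ℝ}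

lemma measurable_heatExt (hf : Measurable f) (x : EuclideanSpace ℝ (Fin n)) :
    Measurable (heatExt n f x) := by
  have h : Measurable (fun p : ℝ × EuclideanSpace ℝ (Fin n) => gaussKer n p.1 (x - p.2) * f p.2) :=
    ((measurable_gaussKer n).comp (measurable_fst.prodMk (measurable_snd.const_sub x))).mul
      (hf.comp measurable_snd)
  exact (h.stronglyMeasurable.integral_prod_right).measurable

lemma measurable_heatExtDeriv (hf : Measurable f) (x : EuclideanSpace ℝ (Fin n)) :
    Measurable (heatExtDeriv n f x) := by
  have h : Measurable (fun p : ℝ × EuclideanSpace ℝ (Fin n) =>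
      gaussKerDeriv n p.1 (x - p.2) * f p.2) :=
    ((measurable_gaussKerDeriv n).comp (measurable_fst.prodMk (measurable_snd.const_sub x))).mul
      (hf.comp measurable_snd)
  exact (h.stronglyMeasurable.integral_prod_right).measurable

lemma heatExt_eq (x : EuclideanSpace ℝ (Fin n)) (a : ℝ) :
    heatExt n f x a = ∫ z, gaussKer n a z * f (x - z) := by
  unfold heatExt
  rw [← integral_sub_left_eq_self _ volume x]
  simp

lemma abs_heatExt_le_sup {M : ℝ} (hM : ∀ x, |f x| ≤ M) (x : EuclideanSpace ℝ (Fin n))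
    {a : ℝ} (ha : 0 < a) : |heatExt n f x a| ≤ M := by
  rw [heatExt_eq]
  have h : ∀ᵐ z, ‖gaussKer n a z * f (x - z)‖ ≤ gaussKer n a z * M := by
    filter_upwards with z
    rw [norm_mul, Real.norm_of_nonneg (gaussKer_nonneg ha.le z)]
    exact mul_le_mul_of_nonneg_left (hM _) (gaussKer_nonneg ha.le z)
  refine (norm_integral_le_of_norm_le ((integrable_gaussKer ha).mul_const M) h).trans_eq ?_
  rw [integral_mul_const, integral_gaussKer ha, one_mul]

lemma abs_heatExt_le (hf : Integrable f) (x : EuclideanSpace ℝ (Fin n)) {a : ℝ} (ha : 0 < a) :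
    |heatExt n f x a| ≤ (π * a) ^ (-(n:ℝ)/2) * ∫ z, |f z| := by
  rw [← integral_const_mul, ← Real.norm_eq_abs, heatExt]
  refine norm_integral_le_of_norm_le (hf.abs.const_mul _) ?_
  filter_upwards with z
  rw [norm_mul, Real.norm_of_nonneg (gaussKer_nonneg ha.le _)]
  exact mul_le_mul_of_nonneg_right (gaussKer_le ha _) (abs_nonneg _)

lemma abs_heatExtDeriv_le (hf : Integrable f) (x : EuclideanSpace ℝ (Fin n)) {a : ℝ} (ha : 0 < a) :
    |heatExtDeriv n f x a| ≤ (π * a) ^ (-(n:ℝ)/2) * (((n:ℝ)/2 + 1) / a) * ∫ z, |f z| := by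
  rw [← integral_const_mul, ← Real.norm_eq_abs, heatExtDeriv]
  refine norm_integral_le_of_norm_le (hf.abs.const_mul _) ?_
  filter_upwards with z
  rw [norm_mul]
  exact mul_le_mul_of_nonneg_right (abs_gaussKerDeriv_le ha _) (abs_nonneg _)

lemma hasDerivAt_heatExt (hf : Integrable f) (x : EuclideanSpace ℝ (Fin n)) {a : ℝ} (ha : 0 < a) :
    HasDerivAt (heatExt n f x) (heatExtDeriv n f x a) a := by
  have hm : ∀ b, AEStronglyMeasurable (fun z => gaussKer n b (x - z)) volume := fun b =>
    ((continuous_gaussKer n b).comp (continuous_const.sub continuous_id)).aestronglyMeasurable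
  have hm' : AEStronglyMeasurable (fun z => gaussKerDeriv n a (x - z)) volume :=
    ((measurable_gaussKerDeriv n).comp
      (measurable_const.prodMk (measurable_id.const_sub x))).aestronglyMeasurable
  refine (hasDerivAt_integral_of_dominated_loc_of_deriv_le (s := Ioi (a/2))
    (F := fun a z => gaussKer n a (x - z) * f z) (F' := fun a z => gaussKerDeriv n a (x - z) * f z)
    (bound := fun z => (π * (a/2)) ^ (-(n:ℝ)/2) * (((n:ℝ)/2 + 1) / (a/2)) * |f z|)
    (Ioi_mem_nhds (by linarith)) (Eventually.of_forall fun b => (hm b).mul hf.1) ?_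
    (hm'.mul hf.1) ?_ (hf.abs.const_mul _) ?_).2
  · refine hf.bdd_mul (c := (π * a) ^ (-(n:ℝ)/2)) (hm a) ?_
    filter_upwards with z
    rw [Real.norm_of_nonneg (gaussKer_nonneg ha.le _)]
    exact gaussKer_le ha _
  · filter_upwards with z b hb
    have hb : a/2 < b := hb
    have hb0 : 0 < b := by linarith
    rw [norm_mul]
    refine mul_le_mul_of_nonneg_right ((abs_gaussKerDeriv_le (by linarith) _).trans ?_)
      (abs_nonneg _)
    have h1 : (π * b) ^ (-(n:ℝ)/2) ≤ (π * (a/2)) ^ (-(n:ℝ)/2) := by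
      apply Real.rpow_le_rpow_of_nonpos (by positivity) (by gcongr)
      have : (0:ℝ) ≤ n := Nat.cast_nonneg n
      linarith
    gcongr
  · filter_upwards with z b hb
    have hb : a/2 < b := hb
    exact (hasDerivAt_gaussKer (by linarith) _).mul_const _

lemma tendsto_heatExt_atTop (hn : 1 ≤ n) (hf : Integrable f) (x : EuclideanSpace ℝ (Fin n)) :
    Tendsto (heatExt n f x) atTop (𝓝 0) := by
  have h1 : Tendsto (fun a : ℝ => (π * a) ^ (-(n:ℝ)/2) * ∫ z, |f z|) atTop (𝓝 0) := by
    have h := (tendsto_rpow_neg_atTop (y := (n:ℝ)/2) (by positivity)).comp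
      (tendsto_id.const_mul_atTop Real.pi_pos)
    have := h.mul_const (∫ z, |f z|)
    simpa [Function.comp_def, neg_div] using this
  refine squeeze_zero_norm' ?_ h1
  filter_upwards [eventually_gt_atTop 0] with a ha
  exact abs_heatExt_le hf x ha

lemma heatExt_eq_integral_scaled (x : EuclideanSpace ℝ (Fin n)) {a : ℝ} (ha : 0 < a) :
    heatExt n f x a = ∫ w, gaussKer n 1 w * f (x - √a • w) := by
  rw [heatExt_eq]
  have h := Measure.integral_comp_smul (volume : Measure (EuclideanSpace ℝ (Fin n)))
    (fun z => gaussKer n a z * f (x - z)) (√a)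
  rw [finrank_euclideanSpace_fin, smul_eq_mul, abs_of_nonneg (by positivity)] at h
  have hsa : 0 < √a := Real.sqrt_pos.2 ha
  rw [inv_mul_eq_div, eq_div_iff (by positivity)] at h
  rw [← h, ← integral_mul_const]
  congr 1
  ext w
  have : gaussKer n a (√a • w) * √a ^ n = gaussKer n 1 w := by
    unfold gaussKer
    rw [norm_smul, Real.norm_of_nonneg hsa.le, mul_pow, Real.sq_sqrt ha.le,
      mul_div_cancel_left₀ _ ha.ne', mul_one, div_one, Real.mul_rpow (by positivity) ha.le,
      Real.sqrt_eq_rpow, ← Real.rpow_natCast (a ^ (1/2 : ℝ)), ← Real.rpow_mul ha.le, neg_div,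
      Real.rpow_neg ha.le, one_div_mul_eq_div]
    have : a ^ ((n:ℝ)/2) ≠ 0 := by positivity
    field_simp
  rw [← this]; ring

lemma tendsto_heatExt_zero (hf : Continuous f) {M : ℝ} (hM : ∀ x, |f x| ≤ M)
    (x : EuclideanSpace ℝ (Fin n)) : Tendsto (heatExt n f x) (𝓝[>] 0) (𝓝 (f x)) := by
  have key : Tendsto (fun a : ℝ => ∫ w, gaussKer n 1 w * f (x - √a • w)) (𝓝[>] 0)
      (𝓝 (∫ w, gaussKer n 1 w * f x)) := by
    refine tendsto_integral_filter_of_dominated_convergence (fun w => gaussKer n 1 w * M) ?_ ?_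
      ((integrable_gaussKer one_pos).mul_const M) ?_
    · refine Eventually.of_forall fun a => ?_
      exact ((continuous_gaussKer n 1).mul (hf.comp (by fun_prop))).aestronglyMeasurable
    · refine Eventually.of_forall fun a => ?_
      filter_upwards with w
      rw [norm_mul, Real.norm_of_nonneg (gaussKer_nonneg zero_le_one _)]
      exact mul_le_mul_of_nonneg_left (hM _) (gaussKer_nonneg zero_le_one _)
    · filter_upwards with w
      have : Continuous (fun a : ℝ => gaussKer n 1 w * f (x - √a • w)) :=
        continuous_const.mul (hf.comp (by fun_prop))
      have := (this.tendsto 0).mono_left (nhdsWithin_le_nhds (s := Ioi 0))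
      simpa using this
  rw [integral_mul_const, integral_gaussKer one_pos, one_mul] at key
  refine key.congr' ?_
  filter_upwards [self_mem_nhdsWithin] with a ha
  exact (heatExt_eq_integral_scaled x ha).symm

lemma integral_heatExt_mul_gaussKer (hf : Integrable f) (x : EuclideanSpace ℝ (Fin n)) {a b : ℝ}
    (ha : 0 < a) (hb : 0 < b) :
    ∫ y, heatExt n f y a * gaussKer n b (x - y) = heatExt n f x (a + b) := by
  unfold heatExt
  simp_rw [← integral_mul_const]
  rw [integral_integral_swap]
  · congr 1
    ext z
    rw [← integral_gaussKer_mul_gaussKer ha hb x z, ← integral_mul_const]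
    congr 1
    ext y; ring
  · have h1 : Integrable (fun p : EuclideanSpace ℝ (Fin n) × EuclideanSpace ℝ (Fin n) =>
        gaussKer n b (x - p.1) * f p.2) (volume.prod volume) :=
      ((integrable_gaussKer hb).comp_sub_left x).mul_prod hf
    have h2 := h1.bdd_mul (c := (π * a) ^ (-(n:ℝ)/2)) (f := fun p => gaussKer n a (p.1 - p.2))
      ((continuous_gaussKer n a).comp (by fun_prop)).aestronglyMeasurable (by
        filter_upwards with p
        rw [Real.norm_of_nonneg (gaussKer_nonneg ha.le _)]
        exact gaussKer_le ha _)
    refine h2.congr ?_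
    filter_upwards with p
    simp only [Function.uncurry]
    ring

end

end

section

open Filter Topology

lemma ae_gammaMeasure_pos (a r : ℝ) : ∀ᵐ μ ∂(ProbabilityTheory.gammaMeasure a r), 0 < μ := by
  unfold ProbabilityTheory.gammaMeasure
  have hm : Measurable (ProbabilityTheory.gammaPDF a r) :=
    (ProbabilityTheory.measurable_gammaPDFReal a r).ennreal_ofReal
  rw [ae_withDensity_iff hm]
  have h0 : ∀ᵐ μ : ℝ, μ ≠ 0 := by simp [ae_iff]
  filter_upwards [h0] with μ h0 h
  by_contra hμ
  exact h (ProbabilityTheory.gammaPDF_of_neg (lt_of_le_of_ne (not_lt.1 hμ) h0))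

lemma integral_gammaMeasure {a r : ℝ} (ha : 0 < a) (hr : 0 < r) (g : ℝ → ℝ) :
    ∫ μ, g μ ∂(ProbabilityTheory.gammaMeasure a r) =
      ∫ μ in Ioi 0, r ^ a / Gamma a * μ ^ (a - 1) * rexp (-(r * μ)) * g μ := by
  unfold ProbabilityTheory.gammaMeasure
  have hm : Measurable (ProbabilityTheory.gammaPDF a r) :=
    (ProbabilityTheory.measurable_gammaPDFReal a r).ennreal_ofReal
  rw [integral_withDensity_eq_integral_toReal_smul hm
    (Eventually.of_forall fun x => ENNReal.ofReal_lt_top), ← integral_Ici_eq_integral_Ioi,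
    ← integral_indicator measurableSet_Ici]
  congr 1
  ext μ
  by_cases h : 0 ≤ μ
  · rw [indicator_of_mem (mem_Ici.2 h), ProbabilityTheory.gammaPDF_of_nonneg h,
      ENNReal.toReal_ofReal,
      smul_eq_mul]
    have := Real.Gamma_pos_of_pos ha
    positivity
  · rw [indicator_of_notMem (by simpa using h), ProbabilityTheory.gammaPDF_of_neg (not_le.1 h)]
    simp

lemma pker_eq_integral_gaussKer {n : ℕ} {s t : ℝ} (hs : 0 < s) (ht : 0 < t)
    (x : EuclideanSpace ℝ (Fin n)) :
    pker n s t x = ∫ μ, gaussKer n (t^2/μ) x ∂(ProbabilityTheory.gammaMeasure (s/2) 1) := by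
  rw [integral_gammaMeasure (by positivity) one_pos]
  have hG : Gamma (s/2) ≠ 0 := (Real.Gamma_pos_of_pos (by positivity)).ne'
  have e : ∀ μ ∈ Ioi (0:ℝ), (1:ℝ) ^ (s/2) / Gamma (s/2) * μ ^ (s/2 - 1) * rexp (-(1 * μ)) *
      gaussKer n (t^2/μ) x = ((π * t^2) ^ (-(n:ℝ)/2) / Gamma (s/2)) *
        (μ ^ (((n:ℝ)+s)/2 - 1) * rexp (-((1 + ‖x‖^2/t^2) * μ))) := by
    intro μ hμ
    have hμ : 0 < μ := hμ
    unfold gaussKer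
    rw [Real.one_rpow, mul_div_assoc', Real.div_rpow (by positivity) hμ.le,
      show ((n:ℝ)+s)/2 - 1 = (n:ℝ)/2 + (s/2 - 1) by ring, Real.rpow_add hμ, neg_div,
      Real.rpow_neg hμ.le,
      show -((1 + ‖x‖^2/t^2) * μ) = -(1*μ) + -(‖x‖^2/(t^2/μ)) by field_simp; ring, Real.exp_add]
    have : μ ^ ((n:ℝ)/2) ≠ 0 := by positivity
    field_simp
  rw [setIntegral_congr_fun measurableSet_Ioi e, integral_const_mul,
    integral_rpow_mul_exp_neg_mul_Ioi (by positivity) (by positivity)]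
  unfold pker cns
  have h1 : (1 / (1 + ‖x‖^2/t^2)) ^ (((n:ℝ)+s)/2) =
      (t^2) ^ (((n:ℝ)+s)/2) * (‖x‖^2 + t^2) ^ (-((n:ℝ)+s)/2) := by
    rw [neg_div, Real.rpow_neg (by positivity), ← div_eq_mul_inv,
      ← Real.div_rpow (by positivity) (by positivity)]
    congr 1
    field_simp
    ring
  have h2 : (t^2) ^ (((n:ℝ)+s)/2) = (t^2) ^ ((n:ℝ)/2) * t ^ s := by
    rw [add_div, Real.rpow_add (by positivity), ← Real.rpow_natCast t 2, ← Real.rpow_mul ht.le _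
        (s/2)]
    congr 2
    push_cast; ring
  rw [h1, h2, Real.mul_rpow (by positivity) (by positivity), neg_div 2 (n:ℝ),
    Real.rpow_neg (by positivity), Real.rpow_neg (by positivity)]
  have : π ^ ((n:ℝ)/2) ≠ 0 := by positivity
  have : (t^2) ^ ((n:ℝ)/2) ≠ 0 := by positivity
  field_simp

section
variable {n : ℕ} {s : ℝ}

lemma integrable_prod_gaussKer (hs : 0 < s) {t : ℝ} (ht : 0 < t) :
    Integrable (fun p : ℝ × EuclideanSpace ℝ (Fin n) => gaussKer n (t^2/p.1) p.2)
      ((ProbabilityTheory.gammaMeasure (s/2) 1).prod volume) := by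
  have := ProbabilityTheory.isProbabilityMeasure_gammaMeasure (a := s/2) (r := 1) (by positivity)
      one_pos
  have hm : Measurable (fun p : ℝ × EuclideanSpace ℝ (Fin n) => gaussKer n (t^2/p.1) p.2) :=
    (measurable_gaussKer n).comp ((measurable_fst.const_div _).prodMk measurable_snd)
  rw [integrable_prod_iff hm.aestronglyMeasurable]
  refine ⟨?_, ?_⟩
  · filter_upwards [ae_gammaMeasure_pos (s/2) 1] with μ hμ
    exact integrable_gaussKer (by positivity)
  · refine (integrable_const (1:ℝ)).congr ?_
    filter_upwards [ae_gammaMeasure_pos (s/2) 1] with μ hμ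
    rw [← integral_gaussKer (n := n) (a := t^2/μ) (by positivity)]
    congr 1
    ext x
    rw [Real.norm_of_nonneg (gaussKer_nonneg (by positivity) x)]

lemma integrable_pker (hs : 0 < s) {t : ℝ} (ht : 0 < t) : Integrable (pker n s t) := by
  have := ProbabilityTheory.isProbabilityMeasure_gammaMeasure (a := s/2) (r := 1) (by positivity)
      one_pos
  refine (integrable_prod_gaussKer hs ht).integral_prod_right.congr ?_
  filter_upwards with x
  exact (pker_eq_integral_gaussKer hs ht x).symm

lemma integral_pker (hs : 0 < s) {t : ℝ} (ht : 0 < t) : ∫ x, pker n s t x = 1 := by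
  have := ProbabilityTheory.isProbabilityMeasure_gammaMeasure (a := s/2) (r := 1) (by positivity)
      one_pos
  simp_rw [pker_eq_integral_gaussKer hs ht]
  rw [integral_integral_swap (f := fun x μ => gaussKer n (t^2/μ) x)
    (integrable_prod_gaussKer hs ht).swap, integral_congr_ae (g := fun _ => (1:ℝ))]
  · simp
  · filter_upwards [ae_gammaMeasure_pos (s/2) 1] with μ hμ
    exact integral_gaussKer (by positivity)

variable {f : EuclideanSpace ℝ (Fin n) → ℝ}

lemma csExt_eq (x : EuclideanSpace ℝ (Fin n)) (t : ℝ) :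
    csExt n s f x t = ∫ z, pker n s t z * f (x - z) := by
  unfold csExt
  rw [← integral_sub_left_eq_self _ volume x]
  simp

lemma csExt_eq_integral_heatExt (hs : 0 < s) (hf : Measurable f) {M : ℝ} (hM : ∀ x, |f x| ≤ M)
    (x : EuclideanSpace ℝ (Fin n)) {t : ℝ} (ht : 0 < t) :
    csExt n s f x t = ∫ μ, heatExt n f x (t^2/μ) ∂(ProbabilityTheory.gammaMeasure (s/2) 1) := by
  have := ProbabilityTheory.isProbabilityMeasure_gammaMeasure (a := s/2) (r := 1) (by positivity)
      one_pos
  rw [csExt_eq]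
  simp_rw [heatExt_eq, pker_eq_integral_gaussKer hs ht, ← integral_mul_const]
  refine integral_integral_swap ?_
  have := (integrable_prod_gaussKer (n := n) hs ht).swap.mul_bdd (c := M)
    (g := fun p => f (x - p.1))
    (hf.comp (measurable_fst.const_sub x)).aestronglyMeasurable (by
      filter_upwards with p using hM _)
  exact this

lemma integral_csExt_mul_gaussKer (hs : 0 < s) (hf : Measurable f) (hfi : Integrable f) {M : ℝ}
    (hM : ∀ x, |f x| ≤ M) (x : EuclideanSpace ℝ (Fin n)) {t b : ℝ} (ht : 0 < t) (hb : 0 < b) :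
    ∫ y, csExt n s f y t * gaussKer n b (x - y) =
      ∫ μ, heatExt n f x (t^2/μ + b) ∂(ProbabilityTheory.gammaMeasure (s/2) 1) := by
  have := ProbabilityTheory.isProbabilityMeasure_gammaMeasure (a := s/2) (r := 1) (by positivity)
      one_pos
  simp_rw [csExt_eq_integral_heatExt hs hf hM _ ht, ← integral_mul_const]
  rw [integral_integral_swap]
  · refine integral_congr_ae ?_
    filter_upwards [ae_gammaMeasure_pos (s/2) 1] with μ hμ
    exact integral_heatExt_mul_gaussKer hfi x (by positivity) hb
  · have h1 : Integrable (fun p : EuclideanSpace ℝ (Fin n) × ℝ => gaussKer n b (x - p.1))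
        (volume.prod (ProbabilityTheory.gammaMeasure (s/2) 1)) :=
      ((integrable_gaussKer hb).comp_sub_left x).comp_fst _
    have hm : Measurable (fun p : EuclideanSpace ℝ (Fin n) × ℝ => heatExt n f p.1 (t^2/p.2)) := by
      have h : Measurable (fun q : (EuclideanSpace ℝ (Fin n) × ℝ) × EuclideanSpace ℝ (Fin n) =>
          gaussKer n (t^2/q.1.2) (q.1.1 - q.2) * f q.2) :=
        ((measurable_gaussKer n).comp (Measurable.prodMk (by fun_prop) (by fun_prop))).mul
          (hf.comp measurable_snd)
      exact (h.stronglyMeasurable.integral_prod_right).measurable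
    refine h1.bdd_mul (c := M) hm.aestronglyMeasurable ?_
    have : ∀ᵐ p : EuclideanSpace ℝ (Fin n) × ℝ
        ∂(volume.prod (ProbabilityTheory.gammaMeasure (s/2) 1)), 0 < p.2 :=
      Measure.quasiMeasurePreserving_snd.ae (ae_gammaMeasure_pos (s/2) 1)
    filter_upwards [this] with p hp
    exact abs_heatExt_le_sup hM _ (by positivity)

end

end

section

open Filter Topology

/-- The derivative of the fractional Poisson kernel in `t`. -/
def pkerDeriv (n : ℕ) (s t : ℝ) (x : EuclideanSpace ℝ (Fin n)) : ℝ :=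
  cns n s * t ^ (s - 1) * (‖x‖^2 + t^2) ^ (-((n:ℝ) + s)/2) *
    (s - ((n:ℝ) + s) * (t^2 / (‖x‖^2 + t^2)))

/-- The `t`-derivative of the Caffarelli–Silvestre extension. -/
def csExtDeriv (n : ℕ) (s : ℝ) (f : EuclideanSpace ℝ (Fin n) → ℝ)
    (x : EuclideanSpace ℝ (Fin n)) (t : ℝ) : ℝ :=
  ∫ z, pkerDeriv n s t z * f (x - z)

lemma cns_pos {n : ℕ} {s : ℝ} (hs : 0 < s) : 0 < cns n s := by
  unfold cns
  have h1 : 0 < Gamma (((n:ℝ)+s)/2) := Real.Gamma_pos_of_pos (by positivity)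
  have h2 : 0 < Gamma (s/2) := Real.Gamma_pos_of_pos (by positivity)
  positivity

section
variable {n : ℕ} {s : ℝ}

lemma pker_nonneg (hs : 0 < s) {t : ℝ} (ht : 0 < t) (x : EuclideanSpace ℝ (Fin n)) :
    0 ≤ pker n s t x := by
  have := cns_pos (n := n) hs
  unfold pker; positivity

lemma hasDerivAt_pker {t : ℝ} (ht : 0 < t) (x : EuclideanSpace ℝ (Fin n)) :
    HasDerivAt (fun t => pker n s t x) (pkerDeriv n s t x) t := by
  unfold pker pkerDeriv
  have h1 : HasDerivAt (fun t : ℝ => cns n s * t ^ s) (cns n s * (s * t ^ (s-1))) t :=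
    (Real.hasDerivAt_rpow_const (Or.inl ht.ne')).const_mul _
  have hpos : 0 < ‖x‖^2 + t^2 := by positivity
  have h2 : HasDerivAt (fun t : ℝ => (‖x‖^2 + t^2) ^ (-((n:ℝ) + s)/2))
      ((2 * t) * (-((n:ℝ) + s)/2) * (‖x‖^2 + t^2) ^ (-((n:ℝ) + s)/2 - 1)) t := by
    have := (((hasDerivAt_pow 2 t).const_add (‖x‖^2))).rpow_const (p := -((n:ℝ) + s)/2)
      (Or.inl hpos.ne')
    simpa using this
  refine (h1.mul h2).congr_deriv ?_
  rw [Real.rpow_sub_one hpos.ne', Real.rpow_sub_one ht.ne']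
  field_simp
  ring

lemma abs_pkerDeriv_le (hs : 0 < s) {t : ℝ} (ht : 0 < t) (x : EuclideanSpace ℝ (Fin n)) :
    |pkerDeriv n s t x| ≤
      cns n s * ((n:ℝ) + 2 * s) * t ^ (s - 1) * (‖x‖^2 + t^2) ^ (-((n:ℝ) + s)/2) := by
  have hc := cns_pos (n := n) hs
  unfold pkerDeriv
  rw [abs_mul, abs_of_nonneg (by positivity)]
  have h1 : t^2 / (‖x‖^2 + t^2) ≤ 1 := div_le_one_of_le₀ (by nlinarith [sq_nonneg ‖x‖])
      (by positivity)
  have h0 : 0 ≤ t^2 / (‖x‖^2 + t^2) := by positivity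
  have hn : (0:ℝ) ≤ n := Nat.cast_nonneg n
  have : |s - ((n:ℝ) + s) * (t^2 / (‖x‖^2 + t^2))| ≤ (n:ℝ) + 2 * s := by
    rw [abs_le]; constructor <;> nlinarith
  calc _ ≤ cns n s * t ^ (s - 1) * (‖x‖^2 + t^2) ^ (-((n:ℝ) + s)/2) * ((n:ℝ) + 2 * s) := by gcongr
    _ = _ := by ring

lemma abs_pkerDeriv_le_pker (hs : 0 < s) {t : ℝ} (ht : 0 < t) (x : EuclideanSpace ℝ (Fin n)) :
    |pkerDeriv n s t x| ≤ ((n:ℝ) + 2 * s) / t * pker n s t x := by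
  refine (abs_pkerDeriv_le hs ht x).trans_eq ?_
  unfold pker
  rw [Real.rpow_sub_one ht.ne']
  field_simp

lemma abs_pkerDeriv_le_pker_half (hs : 0 < s) {t τ : ℝ} (ht : 0 < t) (h1 : t/2 < τ) (h2 : τ < 2*t)
    (x : EuclideanSpace ℝ (Fin n)) :
    |pkerDeriv n s τ x| ≤ ((n:ℝ) + 2 * s) / (t/2) * (4^s * pker n s (t/2) x) := by
  have hc := cns_pos (n := n) hs
  have hτ : 0 < τ := by linarith
  refine (abs_pkerDeriv_le_pker hs hτ x).trans ?_
  have hp : pker n s τ x ≤ 4^s * pker n s (t/2) x := by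
    unfold pker
    have e1 : τ ^ s ≤ 4 ^ s * (t/2) ^ s := by
      rw [← Real.mul_rpow (by norm_num) (by positivity)]
      exact Real.rpow_le_rpow hτ.le (by linarith) hs.le
    have e2 : (‖x‖^2 + τ^2) ^ (-((n:ℝ) + s)/2) ≤ (‖x‖^2 + (t/2)^2) ^ (-((n:ℝ) + s)/2) := by
      apply Real.rpow_le_rpow_of_nonpos (by positivity) (by gcongr)
      have : (0:ℝ) ≤ n := Nat.cast_nonneg n
      linarith
    calc cns n s * τ ^ s * (‖x‖^2 + τ^2) ^ (-((n:ℝ) + s)/2)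
        ≤ cns n s * (4 ^ s * (t/2) ^ s) * (‖x‖^2 + (t/2)^2) ^ (-((n:ℝ) + s)/2) := by gcongr
      _ = _ := by ring
  have := pker_nonneg hs hτ x
  gcongr

lemma measurable_pker (n : ℕ) (s : ℝ) :
    Measurable (fun p : ℝ × EuclideanSpace ℝ (Fin n) => pker n s p.1 p.2) := by
  unfold pker; fun_prop

lemma measurable_pkerDeriv (n : ℕ) (s : ℝ) :
    Measurable (fun p : ℝ × EuclideanSpace ℝ (Fin n) => pkerDeriv n s p.1 p.2) := by
  unfold pkerDeriv; fun_prop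

lemma aestronglyMeasurable_pkerDeriv (n : ℕ) (s t : ℝ) :
    AEStronglyMeasurable (pkerDeriv n s t) volume :=
  ((measurable_pkerDeriv n s).comp (measurable_const.prodMk measurable_id)).aestronglyMeasurable

lemma integrable_pkerDeriv (hs : 0 < s) {t : ℝ} (ht : 0 < t) : Integrable (pkerDeriv n s t) :=
  ((integrable_pker hs ht).const_mul (((n:ℝ) + 2 * s) / t)).mono'
    (aestronglyMeasurable_pkerDeriv n s t)
    (Eventually.of_forall fun x => abs_pkerDeriv_le_pker hs ht x)

lemma hasDerivAt_integral_pker_mul (hs : 0 < s) {φ : EuclideanSpace ℝ (Fin n) → ℝ}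
    (hφ : Measurable φ) {M : ℝ} (hM : ∀ x, |φ x| ≤ M) {t : ℝ} (ht : 0 < t) :
    HasDerivAt (fun t => ∫ z, pker n s t z * φ z) (∫ z, pkerDeriv n s t z * φ z) t := by
  have hm : ∀ b, AEStronglyMeasurable (pker n s b) volume := fun b =>
    ((measurable_pker n s).comp (measurable_const.prodMk measurable_id)).aestronglyMeasurable
  refine (hasDerivAt_integral_of_dominated_loc_of_deriv_le (s := Ioo (t/2) (2*t))
    (F := fun t z => pker n s t z * φ z) (F' := fun t z => pkerDeriv n s t z * φ z)
    (bound := fun z => (((n:ℝ) + 2 * s) / (t/2) * (4^s * pker n s (t/2) z)) * M)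
    (Ioo_mem_nhds (by linarith) (by linarith))
    (Eventually.of_forall fun b => (hm b).mul hφ.aestronglyMeasurable) ?_
    ((aestronglyMeasurable_pkerDeriv n s t).mul hφ.aestronglyMeasurable) ?_ ?_ ?_).2
  · exact (integrable_pker hs ht).mul_bdd (c := M) hφ.aestronglyMeasurable
      (Eventually.of_forall hM)
  · filter_upwards with z τ hτ
    rw [norm_mul]
    have h := abs_pkerDeriv_le_pker_half hs ht hτ.1 hτ.2 z
    exact mul_le_mul h (hM z) (abs_nonneg _) ((abs_nonneg _).trans h)
  · exact (((integrable_pker hs (half_pos ht)).const_mul _).const_mul _).mul_const _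
  · filter_upwards with z τ hτ
    exact (hasDerivAt_pker (by linarith [hτ.1]) z).mul_const _

lemma integral_pkerDeriv (hs : 0 < s) {t : ℝ} (ht : 0 < t) : ∫ z, pkerDeriv n s t z = 0 := by
  have h := hasDerivAt_integral_pker_mul (n := n) hs (φ := fun _ => 1) measurable_const (M := 1)
    (fun _ => by simp) ht
  simp only [mul_one] at h
  have h2 : HasDerivAt (fun t => ∫ z, pker n s t z) 0 t := by
    refine (hasDerivAt_const t (1:ℝ)).congr_of_eventuallyEq ?_
    filter_upwards [Ioi_mem_nhds ht] with τ hτ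
    exact integral_pker hs hτ
  exact h.unique h2

variable {f : EuclideanSpace ℝ (Fin n) → ℝ}

lemma hasDerivAt_csExt (hs : 0 < s) (hf : Measurable f) {M : ℝ} (hM : ∀ x, |f x| ≤ M)
    (x : EuclideanSpace ℝ (Fin n)) {t : ℝ} (ht : 0 < t) :
    HasDerivAt (csExt n s f x) (csExtDeriv n s f x t) t := by
  have h := hasDerivAt_integral_pker_mul hs (φ := fun z => f (x - z))
    (hf.comp (measurable_id.const_sub x)) (fun z => hM _) ht
  have e : csExt n s f x = fun t => ∫ z, pker n s t z * f (x - z) := funext fun t => csExt_eq x t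
  rw [e]
  exact h

lemma abs_csExtDeriv_le (hs : 0 < s) {M : ℝ} (hM : ∀ x, |f x| ≤ M)
    (x : EuclideanSpace ℝ (Fin n)) {t : ℝ} (ht : 0 < t) :
    |csExtDeriv n s f x t| ≤ ((n:ℝ) + 2 * s) / t * M := by
  rw [← Real.norm_eq_abs, csExtDeriv]
  refine (norm_integral_le_of_norm_le
    (((integrable_pker (n := n) hs ht).const_mul (((n:ℝ) + 2 * s) / t)).mul_const M) ?_).trans_eq ?_
  · filter_upwards with z
    rw [norm_mul]
    have h := abs_pkerDeriv_le_pker hs ht z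
    exact mul_le_mul h (hM _) (abs_nonneg _) ((abs_nonneg _).trans h)
  · rw [integral_mul_const, integral_const_mul, integral_pker hs ht, mul_one]

lemma abs_csExt_le (hs : 0 < s) {M : ℝ} (hM : ∀ x, |f x| ≤ M)
    (x : EuclideanSpace ℝ (Fin n)) {t : ℝ} (ht : 0 < t) : |csExt n s f x t| ≤ M := by
  rw [← Real.norm_eq_abs, csExt_eq]
  refine (norm_integral_le_of_norm_le ((integrable_pker (n := n) hs ht).mul_const M) ?_).trans_eq ?_
  · filter_upwards with z
    rw [norm_mul, Real.norm_of_nonneg (pker_nonneg hs ht z)]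
    exact mul_le_mul_of_nonneg_left (hM _) (pker_nonneg hs ht z)
  · rw [integral_mul_const, integral_pker hs ht, one_mul]

lemma measurable_csExt (hf : Measurable f) :
    Measurable (fun p : EuclideanSpace ℝ (Fin n) × ℝ => csExt n s f p.1 p.2) := by
  have h : Measurable (fun q : (EuclideanSpace ℝ (Fin n) × ℝ) × EuclideanSpace ℝ (Fin n) =>
      pker n s q.1.2 (q.1.1 - q.2) * f q.2) :=
    ((measurable_pker n s).comp (Measurable.prodMk (by fun_prop) (by fun_prop))).mul
      (hf.comp measurable_snd)
  exact (h.stronglyMeasurable.integral_prod_right).measurable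

lemma measurable_csExtDeriv (hf : Measurable f) :
    Measurable (fun p : EuclideanSpace ℝ (Fin n) × ℝ => csExtDeriv n s f p.1 p.2) := by
  have h : Measurable (fun q : (EuclideanSpace ℝ (Fin n) × ℝ) × EuclideanSpace ℝ (Fin n) =>
      pkerDeriv n s q.1.2 q.2 * f (q.1.1 - q.2)) :=
    ((measurable_pkerDeriv n s).comp (Measurable.prodMk (by fun_prop) (by fun_prop))).mul
      (hf.comp (by fun_prop))
  exact (h.stronglyMeasurable.integral_prod_right).measurable

lemma hasDerivAt_integral_csExt_mul_gaussKer (hs : 0 < s) (hf : Measurable f) {M : ℝ}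
    (hM : ∀ x, |f x| ≤ M) (x : EuclideanSpace ℝ (Fin n)) {t b : ℝ} (ht : 0 < t) (hb : 0 < b) :
    HasDerivAt (fun t => ∫ y, csExt n s f y t * gaussKer n b (x - y))
      (∫ y, csExtDeriv n s f y t * gaussKer n b (x - y)) t := by
  have hM0 : 0 ≤ M := (abs_nonneg _).trans (hM 0)
  have hg : Integrable (fun y => gaussKer n b (x - y)) := (integrable_gaussKer hb).comp_sub_left x
  have hm : ∀ τ, AEStronglyMeasurable (fun y => csExt n s f y τ) volume := fun τ =>
    ((measurable_csExt hf).comp (measurable_id.prodMk measurable_const)).aestronglyMeasurable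
  refine (hasDerivAt_integral_of_dominated_loc_of_deriv_le (s := Ioi (t/2))
    (F := fun t y => csExt n s f y t * gaussKer n b (x - y))
    (F' := fun t y => csExtDeriv n s f y t * gaussKer n b (x - y))
    (bound := fun y => (((n:ℝ) + 2 * s) / (t/2) * M) * gaussKer n b (x - y))
    (Ioi_mem_nhds (by linarith)) (Eventually.of_forall fun τ => (hm τ).mul hg.1) ?_
    (((measurable_csExtDeriv hf).comp
      (measurable_id.prodMk measurable_const)).aestronglyMeasurable.mul hg.1) ?_
    (hg.const_mul _) ?_).2
  · exact hg.bdd_mul (c := M) (hm t) (Eventually.of_forall fun y => abs_csExt_le hs hM y ht)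
  · filter_upwards with y τ hτ
    have hτ : t/2 < τ := hτ
    have hτ0 : 0 < τ := by linarith
    rw [norm_mul, Real.norm_of_nonneg (gaussKer_nonneg hb.le _)]
    refine mul_le_mul_of_nonneg_right ((abs_csExtDeriv_le hs hM y hτ0).trans ?_)
      (gaussKer_nonneg hb.le _)
    gcongr
  · filter_upwards with y τ hτ
    have hτ : t/2 < τ := hτ
    exact (hasDerivAt_csExt hs hf hM y (by linarith)).mul_const _

end

/-- Differentiation of `τ ↦ ∫ w F(τ² k + b)` under the integral sign. -/
lemma hasDerivAt_integral_comp_sq_mul_add {ν : Measure ℝ} [IsProbabilityMeasure ν]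
    {F F' k w : ℝ → ℝ} (hF : Measurable F) (hF' : Measurable F') (hk : Measurable k)
    (hw : Measurable w) {M : ℝ} (hM : ∀ a, 0 < a → |F a| ≤ M)
    (hd : ∀ a, 0 < a → HasDerivAt F (F' a) a)
    (hb' : ∀ a₀, 0 < a₀ → ∃ C, ∀ a, a₀ ≤ a → |F' a| ≤ C / a)
    (hk0 : ∀ᵐ μ ∂ν, 0 < k μ) (hw1 : ∀ᵐ μ ∂ν, |w μ| ≤ 1) {b t a₀ : ℝ} (hb : 0 ≤ b) (ht : 0 < t)
    (ha₀ : 0 < a₀) (h₀ : ∀ᵐ μ ∂ν, a₀ ≤ (t/2)^2 * k μ + b) :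
    HasDerivAt (fun τ => ∫ μ, w μ * F (τ^2 * k μ + b) ∂ν)
      (∫ μ, w μ * (F' (t^2 * k μ + b) * (2 * t * k μ)) ∂ν) t := by
  obtain ⟨C, hC⟩ := hb' a₀ ha₀
  have hC0 : 0 ≤ C := by
    have h := (abs_nonneg _).trans (hC a₀ le_rfl)
    by_contra hn
    exact absurd h (not_le.2 (div_neg_of_neg_of_pos (not_le.1 hn) ha₀))
  have hmono : ∀ τ, t/2 < τ → ∀ μ, 0 < k μ → a₀ ≤ (t/2)^2 * k μ + b → a₀ ≤ τ^2 * k μ + b := by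
    intro τ hτ μ hμ h
    refine h.trans ?_
    gcongr
  refine (hasDerivAt_integral_of_dominated_loc_of_deriv_le (s := Ioi (t/2))
    (F := fun τ μ => w μ * F (τ^2 * k μ + b))
    (F' := fun τ μ => w μ * (F' (τ^2 * k μ + b) * (2 * τ * k μ)))
    (bound := fun _ => 2 * C / (t/2))
    (Ioi_mem_nhds (by linarith)) (Eventually.of_forall fun τ => ?_) ?_ ?_ ?_
    (integrable_const _) ?_).2
  · exact (hw.mul (hF.comp (by fun_prop))).aestronglyMeasurable
  · refine (integrable_const M).mono' (hw.mul (hF.comp (by fun_prop))).aestronglyMeasurable ?_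
    filter_upwards [hk0, hw1, h₀] with μ h1 h2 h3
    rw [norm_mul]
    have := hM _ (ha₀.trans_le (hmono t (by linarith) μ h1 h3))
    calc _ ≤ 1 * M := mul_le_mul h2 this (abs_nonneg _) zero_le_one
      _ = M := one_mul M
  · exact (hw.mul ((hF'.comp (by fun_prop)).mul (by fun_prop))).aestronglyMeasurable
  · filter_upwards [hk0, hw1, h₀] with μ h1 h2 h3 τ hτ
    have hτ : t/2 < τ := hτ
    have hτ0 : 0 < τ := by linarith
    have ha := hmono τ hτ μ h1 h3
    have h4 := hC _ ha
    rw [norm_mul, norm_mul, Real.norm_of_nonneg (by positivity : 0 ≤ 2 * τ * k μ)]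
    calc ‖w μ‖ * (‖F' (τ^2 * k μ + b)‖ * (2 * τ * k μ))
        ≤ 1 * (C / (τ^2 * k μ + b) * (2 * τ * k μ)) := by
          refine mul_le_mul h2 (mul_le_mul_of_nonneg_right h4 (by positivity)) (by positivity)
            zero_le_one
      _ ≤ 1 * (C / (τ^2 * k μ) * (2 * τ * k μ)) := by
          gcongr; linarith
      _ = 2 * C / τ := by field_simp
      _ ≤ 2 * C / (t/2) := by gcongr
  · filter_upwards [hk0, hw1, h₀] with μ h1 h2 h3 τ hτ
    have h5 := ha₀.trans_le (hmono τ hτ μ h1 h3)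
    have h6 : HasDerivAt (fun τ : ℝ => τ^2 * k μ + b) (2 * τ * k μ) τ := by
      have := ((hasDerivAt_pow 2 τ).mul_const (k μ)).add_const b
      simpa using this
    exact ((hd _ h5).comp τ h6).const_mul (w μ)

end

section

open Filter Topology

/-- The constant `∫ 1/(1+μ)` against the gamma distribution of shape `s/2`. -/
def reproConst (s : ℝ) : ℝ := ∫ μ, 1 / (1 + μ) ∂(ProbabilityTheory.gammaMeasure (s/2) 1)

lemma reproConst_pos {s : ℝ} (hs : 0 < s) : 0 < reproConst s := by
  have := ProbabilityTheory.isProbabilityMeasure_gammaMeasure (a := s/2) (r := 1) (by positivity)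
      one_pos
  have hpos := ae_gammaMeasure_pos (s/2) 1
  unfold reproConst
  rw [integral_pos_iff_support_of_nonneg_ae]
  · have : (Function.support fun μ : ℝ => 1 / (1 + μ)) =ᵐ[ProbabilityTheory.gammaMeasure (s/2) 1]
        (univ : Set ℝ) := by
      filter_upwards [hpos] with μ hμ
      have : (1 / (1 + μ)) ≠ 0 := by positivity
      exact propext ⟨fun _ => trivial, fun _ => this⟩
    rw [measure_congr this]
    simp
  · filter_upwards [hpos] with μ hμ
    simp only [Pi.zero_apply]
    positivity
  · refine (integrable_const (1:ℝ)).mono'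
      (by fun_prop : Measurable fun μ : ℝ => 1 / (1 + μ)).aestronglyMeasurable ?_
    filter_upwards [hpos] with μ hμ
    rw [Real.norm_of_nonneg (by positivity)]
    exact div_le_one_of_le₀ (by linarith) (by positivity)

section
variable {n : ℕ} {s : ℝ} {f : EuclideanSpace ℝ (Fin n) → ℝ}

lemma exists_abs_heatExtDeriv_le_div (hfi : Integrable f) (x : EuclideanSpace ℝ (Fin n))
    {a₀ : ℝ} (ha₀ : 0 < a₀) : ∃ C, ∀ a, a₀ ≤ a → |heatExtDeriv n f x a| ≤ C / a := by
  refine ⟨(π * a₀) ^ (-(n:ℝ)/2) * ((n:ℝ)/2 + 1) * ∫ z, |f z|, fun a ha => ?_⟩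
  have ha' : 0 < a := ha₀.trans_le ha
  refine (abs_heatExtDeriv_le hfi x ha').trans ?_
  have hI : 0 ≤ ∫ z, |f z| := integral_nonneg fun z => abs_nonneg _
  have h1 : (π * a) ^ (-(n:ℝ)/2) ≤ (π * a₀) ^ (-(n:ℝ)/2) := by
    apply Real.rpow_le_rpow_of_nonpos (by positivity) (by gcongr)
    have : (0:ℝ) ≤ n := Nat.cast_nonneg n
    linarith
  calc _ ≤ (π * a₀) ^ (-(n:ℝ)/2) * (((n:ℝ)/2 + 1) / a) * ∫ z, |f z| := by gcongr
    _ = _ := by ring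

lemma hasDerivAt_reproPrimitive (hs : 0 < s) (hf : Measurable f) (hfi : Integrable f)
    {M : ℝ} (hM : ∀ x, |f x| ≤ M) (x : EuclideanSpace ℝ (Fin n)) {t : ℝ} (ht : 0 < t) :
    HasDerivAt (fun τ => ∫ μ, 1 / (1 + μ) * heatExt n f x (τ^2 * (1 + 1/μ) + 0)
        ∂(ProbabilityTheory.gammaMeasure (s/2) 1))
      (∫ y, csExtDeriv n s f y t * gaussKer n (t^2) (x - y)) t := by
  have := ProbabilityTheory.isProbabilityMeasure_gammaMeasure (a := s/2) (r := 1) (by positivity)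
      one_pos
  have hpos := ae_gammaMeasure_pos (s/2) 1
  have hF := measurable_heatExt hf x
  have hF' := measurable_heatExtDeriv hf x
  have hMF : ∀ a, 0 < a → |heatExt n f x a| ≤ M := fun a ha => abs_heatExt_le_sup hM x ha
  have hd : ∀ a, 0 < a → HasDerivAt (heatExt n f x) (heatExtDeriv n f x a) a :=
    fun a ha => hasDerivAt_heatExt hfi x ha
  have hb' : ∀ a₀, 0 < a₀ → ∃ C, ∀ a, a₀ ≤ a → |heatExtDeriv n f x a| ≤ C / a :=
    fun a₀ ha₀ => exists_abs_heatExtDeriv_le_div hfi x ha₀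
  have h1 := hasDerivAt_integral_comp_sq_mul_add (ν := ProbabilityTheory.gammaMeasure (s/2) 1)
    hF hF' (k := fun μ => 1/μ) (w := fun _ => 1) (by fun_prop) (by fun_prop) hMF hd hb'
    (by filter_upwards [hpos] with μ hμ using by positivity) (by simp)
    (b := t^2) (t := t) (a₀ := t^2) (by positivity) ht (by positivity)
    (by filter_upwards [hpos] with μ hμ
        have : 0 ≤ (t/2)^2 * (1/μ) := by positivity
        linarith)
  have h2 := hasDerivAt_integral_comp_sq_mul_add (ν := ProbabilityTheory.gammaMeasure (s/2) 1)
    hF hF' (k := fun μ => 1 + 1/μ) (w := fun μ => 1/(1+μ)) (by fun_prop) (by fun_prop) hMF hd hb'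
    (by filter_upwards [hpos] with μ hμ using by positivity)
    (by filter_upwards [hpos] with μ hμ
        rw [abs_of_nonneg (by positivity)]
        exact div_le_one_of_le₀ (by linarith) (by positivity))
    (b := 0) (t := t) (a₀ := (t/2)^2) le_rfl ht (by positivity)
    (by filter_upwards [hpos] with μ hμ
        have : 0 ≤ (t/2)^2 * (1/μ) := by positivity
        linarith)
  have h3 := hasDerivAt_integral_csExt_mul_gaussKer (b := t^2) hs hf hM x ht (by positivity)
  have h4 : HasDerivAt (fun τ => ∫ y, csExt n s f y τ * gaussKer n (t^2) (x - y))
      (∫ μ, 1 * (heatExtDeriv n f x (t^2 * (1/μ) + t^2) * (2 * t * (1/μ)))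
        ∂(ProbabilityTheory.gammaMeasure (s/2) 1)) t := by
    refine h1.congr_of_eventuallyEq ?_
    filter_upwards [Ioi_mem_nhds ht] with τ hτ
    rw [integral_csExt_mul_gaussKer hs hf hfi hM x hτ (by positivity)]
    simp only [one_mul, mul_one_div]
  refine h2.congr_deriv ?_
  rw [h3.unique h4]
  refine integral_congr_ae ?_
  filter_upwards [hpos] with μ hμ
  have e : t^2 * (1 + 1/μ) + 0 = t^2 * (1/μ) + t^2 := by ring
  rw [e]
  field_simp
  ring

lemma tendsto_reproPrimitive {l : Filter ℝ} [l.IsCountablyGenerated] (hs : 0 < s)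
    (hf : Measurable f) {M : ℝ} (hM : ∀ x, |f x| ≤ M) (x : EuclideanSpace ℝ (Fin n)) {L : ℝ}
    (hl : ∀ᶠ τ in l, 0 < τ)
    (h : ∀ k, 1 ≤ k → Tendsto (fun τ => heatExt n f x (τ^2 * k + 0)) l (𝓝 L)) :
    Tendsto (fun τ => ∫ μ, 1 / (1 + μ) * heatExt n f x (τ^2 * (1 + 1/μ) + 0)
        ∂(ProbabilityTheory.gammaMeasure (s/2) 1)) l (𝓝 (reproConst s * L)) := by
  have := ProbabilityTheory.isProbabilityMeasure_gammaMeasure (a := s/2) (r := 1) (by positivity)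
      one_pos
  have hpos := ae_gammaMeasure_pos (s/2) 1
  unfold reproConst
  rw [← integral_mul_const]
  refine tendsto_integral_filter_of_dominated_convergence (fun _ => M) ?_ ?_ (integrable_const _) ?_
  · refine Eventually.of_forall fun τ => ?_
    have := (measurable_heatExt hf x).comp
      (by fun_prop : Measurable fun μ : ℝ => τ^2 * (1 + 1/μ) + 0)
    exact ((by fun_prop : Measurable fun μ : ℝ => 1 / (1 + μ)).mul this).aestronglyMeasurable
  · filter_upwards [hl] with τ hτ
    filter_upwards [hpos] with μ hμ
    rw [norm_mul, Real.norm_of_nonneg (by positivity)]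
    have h1 : 1 / (1 + μ) ≤ 1 := div_le_one_of_le₀ (by linarith) (by positivity)
    calc _ ≤ 1 * M := mul_le_mul h1 (abs_heatExt_le_sup hM x (by positivity)) (abs_nonneg _)
          zero_le_one
      _ = M := one_mul M
  · filter_upwards [hpos] with μ hμ
    exact (h _ (le_add_of_nonneg_right (by positivity))).const_mul _

/-- A Calderón-type reproducing inequality: `f` is controlled by Gaussian averages of `∂ₜu`. -/
lemma reproConst_mul_abs_le (hn : 1 ≤ n) (hs : 0 < s) (hf : Continuous f) (hfi : Integrable f)
    {M : ℝ} (hM : ∀ x, |f x| ≤ M) (x : EuclideanSpace ℝ (Fin n)) :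
    ENNReal.ofReal (reproConst s * |f x|) ≤ ∫⁻ t in Ioi (0:ℝ),
      ∫⁻ y, ‖csExtDeriv n s f y t‖ₑ * ENNReal.ofReal (gaussKer n (t^2) (x - y)) := by
  set h : ℝ → ℝ := fun t => ∫ y, csExtDeriv n s f y t * gaussKer n (t^2) (x - y) with hh
  have hle : ∫⁻ t in Ioi (0:ℝ), ‖h t‖ₑ ≤ ∫⁻ t in Ioi (0:ℝ),
      ∫⁻ y, ‖csExtDeriv n s f y t‖ₑ * ENNReal.ofReal (gaussKer n (t^2) (x - y)) := by
    refine lintegral_mono fun t => (enorm_integral_le_lintegral_enorm _).trans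
        (lintegral_mono fun y => ?_)
    rw [enorm_mul, Real.enorm_eq_ofReal (gaussKer_nonneg (by positivity) _)]
  refine le_trans ?_ hle
  by_cases htop : ∫⁻ t in Ioi (0:ℝ), ‖h t‖ₑ = ⊤
  · rw [htop]; exact le_top
  have hmeas : Measurable h := by
    have hm : Measurable (fun p : ℝ × EuclideanSpace ℝ (Fin n) =>
        csExtDeriv n s f p.2 p.1 * gaussKer n (p.1^2) (x - p.2)) :=
      ((measurable_csExtDeriv hf.measurable).comp measurable_swap).mul
        ((measurable_gaussKer n).comp (Measurable.prodMk (by fun_prop) (by fun_prop)))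
    exact (hm.stronglyMeasurable.integral_prod_right).measurable
  have hle_int : IntegrableOn h (Ioi 0) := ⟨hmeas.aestronglyMeasurable, lt_top_iff_ne_top.2 htop⟩
  set H : ℝ → ℝ := fun τ => ∫ μ, 1 / (1 + μ) * heatExt n f x (τ^2 * (1 + 1/μ) + 0)
        ∂(ProbabilityTheory.gammaMeasure (s/2) 1) with hH
  have h0 : Tendsto H (𝓝[>] 0) (𝓝 (reproConst s * f x)) := by
    refine tendsto_reproPrimitive hs hf.measurable hM x self_mem_nhdsWithin fun k hk => ?_
    refine (tendsto_heatExt_zero hf hM x).comp ?_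
    refine tendsto_nhdsWithin_iff.2 ⟨?_, ?_⟩
    · have : Continuous (fun τ : ℝ => τ^2 * k + 0) := by fun_prop
      simpa using (this.tendsto 0).mono_left nhdsWithin_le_nhds
    · filter_upwards [self_mem_nhdsWithin] with τ hτ
      have hτ : 0 < τ := hτ
      simp only [mem_Ioi]; positivity
  have hinf : Tendsto H atTop (𝓝 0) := by
    have := tendsto_reproPrimitive (L := 0) hs hf.measurable hM x (eventually_gt_atTop 0) fun k hk
        => by
      refine (tendsto_heatExt_atTop hn hfi x).comp ?_
      simp only [add_zero]
      exact (tendsto_pow_atTop two_ne_zero).atTop_mul_const (by linarith)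
    rwa [mul_zero] at this
  have hFTC := integral_Ioi_of_hasDerivAt_of_tendsto (a := 0) (m := 0)
    (f := Function.update H 0 (reproConst s * f x)) (f' := h)
    (by rw [continuousWithinAt_update_same]; simpa using h0)
    (fun t ht => by
      have ht : 0 < t := ht
      refine (hasDerivAt_reproPrimitive hs hf.measurable hfi hM x ht).congr_of_eventuallyEq ?_
      filter_upwards [Ioi_mem_nhds ht] with τ hτ
      exact Function.update_of_ne (ne_of_gt hτ) _ _) hle_int
    (hinf.congr' (by
      filter_upwards [eventually_gt_atTop 0] with τ hτ
      exact (Function.update_of_ne (ne_of_gt hτ) _ _).symm))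
  rw [Function.update_self, zero_sub] at hFTC
  calc ENNReal.ofReal (reproConst s * |f x|) = ‖∫ t in Ioi (0:ℝ), h t‖ₑ := by
        rw [hFTC, enorm_neg, Real.enorm_eq_ofReal_abs, abs_mul, abs_of_pos (reproConst_pos hs)]
    _ ≤ _ := enorm_integral_le_lintegral_enorm _

end

end

section

open Filter Topology

lemma rpow_le_mul_rpow_of_le_mul {A B k e : ℝ} (hk : 0 < k) (hA : 0 < A) (h : A ≤ k * B)
    (he : e ≤ 0) : B ^ e ≤ k ^ (-e) * A ^ e := by
  have hB : A / k ≤ B := by rwa [div_le_iff₀' hk]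
  calc B ^ e ≤ (A / k) ^ e := Real.rpow_le_rpow_of_nonpos (by positivity) hB he
    _ = _ := by
      rw [Real.div_rpow hA.le hk.le, Real.rpow_neg hk.le]
      ring

section
variable {n : ℕ} {s : ℝ} {f : EuclideanSpace ℝ (Fin n) → ℝ}

lemma exists_abs_second_difference_le (hf : ContDiff ℝ (⊤ : ℕ∞) f) (hc : HasCompactSupport f) :
    ∃ L : ℝ, 0 ≤ L ∧ ∀ x z, |f (x - z) + f (x + z) - 2 * f x| ≤ L * ‖z‖ ^ 2 := by
  have h1 : ContDiff ℝ 1 (fderiv ℝ f) :=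
    hf.fderiv_right (by exact WithTop.coe_le_coe.2 le_top)
  obtain ⟨K, hK⟩ := h1.lipschitzWith_of_hasCompactSupport (hc.fderiv ℝ) (by norm_num)
  have hd : Differentiable ℝ f := hf.differentiable (by simp)
  have key : ∀ x z, ‖f (x + z) - f x - fderiv ℝ f x z‖ ≤ K * ‖z‖ * ‖z‖ := by
    intro x z
    have := (convex_closedBall x ‖z‖).norm_image_sub_le_of_norm_hasFDerivWithin_le'
      (f := f) (f' := fderiv ℝ f) (φ := fderiv ℝ f x) (C := K * ‖z‖) (x := x) (y := x + z)
      (fun y _ => (hd y).hasFDerivAt.hasFDerivWithinAt) (fun y hy => by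
        refine (hK.norm_sub_le y x).trans ?_
        rw [mem_closedBall, dist_eq_norm] at hy
        gcongr) (mem_closedBall_self (norm_nonneg _)) (by simp)
    simpa using this
  refine ⟨2 * K, by positivity, fun x z => ?_⟩
  have e : f (x - z) + f (x + z) - 2 * f x = (f (x + z) - f x - fderiv ℝ f x z)
      + (f (x + -z) - f x - fderiv ℝ f x (-z)) := by
    rw [map_neg, ← sub_eq_add_neg]; ring
  rw [e]
  have a := key x z
  have b := key x (-z)
  rw [norm_neg] at b
  refine (abs_add_le _ _).trans ?_
  rw [Real.norm_eq_abs] at a b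
  nlinarith

lemma pkerDeriv_neg (n : ℕ) (s t : ℝ) (x : EuclideanSpace ℝ (Fin n)) :
    pkerDeriv n s t (-x) = pkerDeriv n s t x := by
  simp [pkerDeriv]

lemma two_mul_csExtDeriv (hs : 0 < s) (hf : Continuous f) {M : ℝ} (hM : ∀ x, |f x| ≤ M)
    (x : EuclideanSpace ℝ (Fin n)) {t : ℝ} (ht : 0 < t) :
    2 * csExtDeriv n s f x t =
      ∫ z, pkerDeriv n s t z * (f (x - z) + f (x + z) - 2 * f x) := by
  have hi := integrable_pkerDeriv (n := n) hs ht
  have i1 : Integrable (fun z => pkerDeriv n s t z * f (x - z)) :=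
    hi.mul_bdd (c := M) (by fun_prop) (Eventually.of_forall fun z => hM _)
  have i2 : Integrable (fun z => pkerDeriv n s t z * f (x + z)) :=
    hi.mul_bdd (c := M) (by fun_prop) (Eventually.of_forall fun z => hM _)
  have e2 : ∫ z, pkerDeriv n s t z * f (x + z) = csExtDeriv n s f x t := by
    rw [csExtDeriv, ← integral_neg_eq_self]
    simp [pkerDeriv_neg, sub_eq_add_neg]
  have e3 : (fun z => pkerDeriv n s t z * (f (x - z) + f (x + z) - 2 * f x)) =
    fun z => (pkerDeriv n s t z * f (x - z) + pkerDeriv n s t z * f (x + z))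
      - pkerDeriv n s t z * (2 * f x) := by ext; ring
  rw [e3, integral_sub (by exact i1.add i2) (hi.mul_const _), integral_add i1 i2, e2,
      integral_mul_const,
    integral_pkerDeriv hs ht, csExtDeriv]
  ring

lemma exists_abs_csExtDeriv_le_rpow (hn : 1 ≤ n) (hs : 0 < s) (hs2 : s < 2)
    (hf : ContDiff ℝ (⊤ : ℕ∞) f) (hc : HasCompactSupport f) :
    ∃ C : ℝ, 0 ≤ C ∧ ∀ x t, 0 < t → |csExtDeriv n s f x t| ≤ C * t ^ (s - 1) := by
  obtain ⟨L, hL0, hL⟩ := exists_abs_second_difference_le hf hc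
  obtain ⟨M, hM⟩ := hc.exists_bound_of_continuous hf.continuous
  have hM0 : 0 ≤ M := (norm_nonneg _).trans (hM 0)
  have hcn := cns_pos (n := n) hs
  set H : EuclideanSpace ℝ (Fin n) → ℝ := fun z =>
    (ball 0 1).indicator (fun z => L * ‖z‖ ^ (-((n:ℝ) + s - 2))) z +
      4 * M * 2 ^ (((n:ℝ) + s)/2) * (1 + ‖z‖^2) ^ (-((n:ℝ) + s)/2) with hH
  have hfin : Module.finrank ℝ (EuclideanSpace ℝ (Fin n)) = n := by simp
  have hHi : Integrable H := by
    refine Integrable.add ?_ ((integrable_rpow_neg_one_add_norm_sq ?_).const_mul _)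
    · rw [integrable_indicator_iff measurableSet_ball]
      refine integrableOn_ball_of_norm_le_rpow (C := L) (α := (n:ℝ) + s - 2) ?_ ?_ ?_ ?_
      · rw [hfin]; exact hn
      · rw [hfin]; linarith
      · refine Eventually.of_forall fun z => le_of_eq ?_
        rw [Real.norm_of_nonneg (by positivity)]
      · exact Measurable.aestronglyMeasurable (by fun_prop)
    · rw [hfin]; linarith
  have hbound : ∀ x t, 0 < t → ∀ z,
      (‖z‖^2 + t^2) ^ (-((n:ℝ) + s)/2) * |f (x - z) + f (x + z) - 2 * f x| ≤ H z := by
    intro x t ht z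
    have hneg : -((n:ℝ) + s)/2 ≤ 0 := by
      have : (0:ℝ) ≤ n := Nat.cast_nonneg n
      linarith
    by_cases hz : z ∈ ball (0 : EuclideanSpace ℝ (Fin n)) 1
    · have h2 : 0 ≤ 4 * M * 2 ^ (((n:ℝ) + s)/2) * (1 + ‖z‖^2) ^ (-((n:ℝ) + s)/2) := by positivity
      rw [hH]
      simp only [indicator_of_mem hz]
      refine le_trans ?_ (le_add_of_nonneg_right h2)
      rcases eq_or_ne z 0 with rfl | hz0
      · have : f (x - 0) + f (x + 0) - 2 * f x = 0 := by simp; ring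
        rw [this, abs_zero, mul_zero]; positivity
      have hzp : 0 < ‖z‖ := norm_pos_iff.mpr hz0
      calc _ ≤ (‖z‖^2) ^ (-((n:ℝ) + s)/2) * (L * ‖z‖^2) := by
            exact mul_le_mul (Real.rpow_le_rpow_of_nonpos (by positivity) (by nlinarith) hneg)
              (hL x z) (abs_nonneg _) (by positivity)
        _ = _ := by
            rw [← Real.rpow_natCast ‖z‖ 2, ← Real.rpow_mul hzp.le, mul_left_comm,
              ← Real.rpow_add hzp]
            congr 2; push_cast; ring
    · rw [hH]
      simp only [indicator_of_notMem hz, zero_add]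
      have hz1 : 1 ≤ ‖z‖ := by simpa using hz
      have hD : |f (x - z) + f (x + z) - 2 * f x| ≤ 4 * M := by
        have a := abs_le.mp (hM (x - z)); have b := abs_le.mp (hM (x + z))
        have c := abs_le.mp (hM x)
        rw [abs_le]; constructor <;> linarith
      have hp : (‖z‖^2 + t^2) ^ (-((n:ℝ) + s)/2) ≤
          2 ^ (((n:ℝ) + s)/2) * (1 + ‖z‖^2) ^ (-((n:ℝ) + s)/2) := by
        have := rpow_le_mul_rpow_of_le_mul (A := 1 + ‖z‖^2) (B := ‖z‖^2 + t^2) two_pos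
            (by positivity)
          (by nlinarith) hneg
        rwa [show -(-((n:ℝ) + s)/2) = ((n:ℝ) + s)/2 by ring] at this
      calc _ ≤ (2 ^ (((n:ℝ) + s)/2) * (1 + ‖z‖^2) ^ (-((n:ℝ) + s)/2)) * (4 * M) := by gcongr
        _ = _ := by ring
  have hH0 : ∀ z, 0 ≤ H z := fun z =>
    le_trans (by positivity) (hbound 0 1 one_pos z)
  have hI0 : 0 ≤ ∫ z, H z := integral_nonneg hH0
  refine ⟨cns n s * ((n:ℝ) + 2 * s) * ∫ z, H z, by positivity, fun x t ht => ?_⟩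
  have h2 := two_mul_csExtDeriv hs hf.continuous hM x ht
  have h3 : ‖2 * csExtDeriv n s f x t‖ ≤
      ∫ z, cns n s * ((n:ℝ) + 2 * s) * t ^ (s - 1) * H z := by
    rw [h2]
    refine norm_integral_le_of_norm_le (hHi.const_mul _) (Eventually.of_forall fun z => ?_)
    rw [norm_mul, Real.norm_eq_abs, Real.norm_eq_abs]
    calc _ ≤ (cns n s * ((n:ℝ) + 2 * s) * t ^ (s - 1) * (‖z‖^2 + t^2) ^ (-((n:ℝ) + s)/2)) *
          |f (x - z) + f (x + z) - 2 * f x| := by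
            gcongr; exact abs_pkerDeriv_le hs ht z
      _ = cns n s * ((n:ℝ) + 2 * s) * t ^ (s - 1) * ((‖z‖^2 + t^2) ^ (-((n:ℝ) + s)/2) *
          |f (x - z) + f (x + z) - 2 * f x|) := by ring
      _ ≤ _ := by gcongr; exact hbound x t ht z
  rw [integral_const_mul, norm_mul, Real.norm_eq_abs, Real.norm_eq_abs, abs_two] at h3
  have : 0 ≤ |csExtDeriv n s f x t| := abs_nonneg _
  linarith [mul_right_comm (cns n s * ((n:ℝ) + 2 * s)) (∫ z, H z) (t ^ (s-1))]

lemma one_add_le_mul_norm_sub_sq_add {x y : EuclideanSpace ℝ (Fin n)} {R t : ℝ} (hR : 1 ≤ R)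
    (hy : ‖y‖ ≤ R) (h : 2 + 4 * R^2 < 1 + (‖x‖^2 + t^2)) :
    1 + (‖x‖^2 + t^2) ≤ (8 + 4 * R^2) * (‖x - y‖^2 + t^2) := by
  have h1 := norm_sub_norm_le x y
  rcases le_or_gt (2 * R) ‖x‖ with hx | hx
  · have h2 : ‖x‖ ≤ 2 * ‖x - y‖ := by linarith
    have h3 : ‖x‖^2 ≤ 4 * ‖x - y‖^2 := by nlinarith [norm_nonneg x]
    have h4 : 1 ≤ ‖x - y‖^2 := by nlinarith
    nlinarith [mul_nonneg (sq_nonneg R) (sq_nonneg ‖x - y‖), mul_nonneg (sq_nonneg R) (sq_nonneg t),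
      sq_nonneg t]
  · have h3 : ‖x‖^2 ≤ 4 * R^2 := by nlinarith [norm_nonneg x]
    have h4 : 1 ≤ t^2 := by linarith
    nlinarith [mul_nonneg (sq_nonneg R) (sq_nonneg ‖x - y‖), sq_nonneg ‖x - y‖,
      mul_nonneg (sq_nonneg R) (sub_nonneg.2 h4)]

lemma exists_abs_csExtDeriv_le (hn : 1 ≤ n) (hs : 0 < s) (hs2 : s < 2)
    (hf : ContDiff ℝ (⊤ : ℕ∞) f) (hc : HasCompactSupport f) :
    ∃ C : ℝ, 0 ≤ C ∧ ∀ x t, 0 < t →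
      |csExtDeriv n s f x t| ≤ C * t ^ (s - 1) * (1 + (‖x‖^2 + t^2)) ^ (-((n:ℝ) + s)/2) := by
  obtain ⟨C, hC0, hC⟩ := exists_abs_csExtDeriv_le_rpow hn hs hs2 hf hc
  obtain ⟨R, hR1, hR⟩ : ∃ R : ℝ, 1 ≤ R ∧ ∀ y, R < ‖y‖ → f y = 0 := by
    obtain ⟨R, hR⟩ := hc.isBounded.subset_closedBall 0
    refine ⟨max 1 R, le_max_left _ _, fun y hy => ?_⟩
    by_contra h0
    have := hR (subset_tsupport f h0)
    rw [mem_closedBall_zero_iff] at this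
    exact absurd (this.trans (le_max_right 1 R)) (not_le.2 hy)
  have hcn := cns_pos (n := n) hs
  have hfi : Integrable f := hf.continuous.integrable_of_hasCompactSupport hc
  set e : ℝ := -((n:ℝ) + s)/2 with he
  have hneg : e ≤ 0 := by
    have : (0:ℝ) ≤ n := Nat.cast_nonneg n
    rw [he]; linarith
  have hI : 0 ≤ ∫ y, |f y| := integral_nonneg fun _ => abs_nonneg _
  set K : ℝ := cns n s * ((n:ℝ) + 2 * s) * (8 + 4 * R^2) ^ (-e) * ∫ y, |f y| with hK
  have hK0 : 0 ≤ K := by positivity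
  refine ⟨C * (2 + 4 * R^2) ^ (-e) + K, by positivity, fun x t ht => ?_⟩
  have hA : 0 < 1 + (‖x‖^2 + t^2) := by positivity
  rcases le_or_gt (1 + (‖x‖^2 + t^2)) (2 + 4 * R^2) with h | h
  · have h1 := rpow_le_mul_rpow_of_le_mul (B := 1) (k := 2 + 4 * R^2) (by positivity) hA
      (by linarith) hneg
    rw [Real.one_rpow] at h1
    calc _ ≤ C * t ^ (s-1) * 1 := by rw [mul_one]; exact hC x t ht
      _ ≤ C * t ^ (s-1) * ((2 + 4 * R^2) ^ (-e) * (1 + (‖x‖^2 + t^2)) ^ e) := by gcongr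
      _ = C * (2 + 4 * R^2) ^ (-e) * t ^ (s-1) * (1 + (‖x‖^2 + t^2)) ^ e := by ring
      _ ≤ _ := by gcongr; linarith
  · set W : ℝ := cns n s * ((n:ℝ) + 2 * s) * t ^ (s - 1) *
      ((8 + 4 * R^2) ^ (-e) * (1 + (‖x‖^2 + t^2)) ^ e) with hW
    have h1 : ‖csExtDeriv n s f x t‖ ≤ ∫ z, W * |f (x - z)| := by
      refine norm_integral_le_of_norm_le ((hfi.comp_sub_left x).abs.const_mul _)
        (Eventually.of_forall fun z => ?_)
      rw [norm_mul, Real.norm_eq_abs, Real.norm_eq_abs]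
      rcases lt_or_ge R ‖x - z‖ with h0 | h0
      · simp [hR _ h0]
      gcongr
      refine (abs_pkerDeriv_le hs ht z).trans ?_
      have h2 := one_add_le_mul_norm_sub_sq_add hR1 h0 h
      rw [sub_sub_cancel] at h2
      rw [hW]
      gcongr
      exact rpow_le_mul_rpow_of_le_mul (by positivity) hA h2 hneg
    rw [integral_const_mul, integral_sub_left_eq_self (fun y => |f y|) volume x] at h1
    calc _ ≤ W * ∫ y, |f y| := h1
      _ = K * t ^ (s-1) * (1 + (‖x‖^2 + t^2)) ^ e := by rw [hW, hK]; ring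
      _ ≤ _ := by
        gcongr
        have : 0 ≤ C * (2 + 4 * R^2) ^ (-e) := by positivity
        linarith

lemma integrableOn_rpow_mul_one_add_sq {s β : ℝ} (hs : 0 < s) (hβ : 0 < β) (hβs : β < 2 * s) :
    IntegrableOn (fun t : ℝ => t ^ (2 * s - 1 - β) * (1 + t^2) ^ (-s)) (Ioi 0) := by
  have hm : Measurable (fun t : ℝ => t ^ (2 * s - 1 - β) * (1 + t^2) ^ (-s)) := by fun_prop
  rw [← Ioc_union_Ioi_eq_Ioi zero_le_one]
  refine IntegrableOn.union ?_ ?_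
  · have h := (intervalIntegral.intervalIntegrable_rpow' (a := 0) (b := 1)
      (r := 2 * s - 1 - β) (by linarith)).1
    refine h.mono' hm.aestronglyMeasurable ?_
    filter_upwards [self_mem_ae_restrict measurableSet_Ioc] with t ht
    have ht0 := ht.1
    rw [Real.norm_of_nonneg (by positivity)]
    refine mul_le_of_le_one_right (by positivity) ?_
    exact Real.rpow_le_one_of_one_le_of_nonpos (by nlinarith [sq_nonneg t]) (by linarith)
  · have h := integrableOn_Ioi_rpow_of_lt (a := -1 - β) (c := 1) (by linarith) one_pos
    refine h.mono' hm.aestronglyMeasurable ?_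
    filter_upwards [self_mem_ae_restrict measurableSet_Ioi] with t ht
    have ht0 : 0 < t := lt_trans one_pos ht
    rw [Real.norm_of_nonneg (by positivity)]
    calc _ ≤ t ^ (2 * s - 1 - β) * (t^2) ^ (-s) := by
          exact mul_le_mul_of_nonneg_left
            (Real.rpow_le_rpow_of_nonpos (by positivity) (by linarith) (by linarith))
                (by positivity)
      _ = _ := by
          rw [← Real.rpow_natCast t 2, ← Real.rpow_mul ht0.le, ← Real.rpow_add ht0]
          congr 1; push_cast; ring

lemma integrable_csExtDeriv_sq {β : ℝ} (hn : 1 ≤ n) (hs : 0 < s) (hs2 : s < 2)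
    (hβ : 0 < β) (hβs : β < 2 * s)
    (hf : ContDiff ℝ (⊤ : ℕ∞) f) (hc : HasCompactSupport f) :
    Integrable (fun z : EuclideanSpace ℝ (Fin n) × ℝ =>
      (csExtDeriv n s f z.1 z.2)^2 * z.2 ^ (1 - β)) (volume.prod (volume.restrict (Ioi 0))) := by
  obtain ⟨C, hC0, hC⟩ := exists_abs_csExtDeriv_le hn hs hs2 hf hc
  have hn' : (1:ℝ) ≤ n := by exact_mod_cast hn
  have h1 : Integrable (fun x : EuclideanSpace ℝ (Fin n) => (1 + ‖x‖^2) ^ (-(2 * (n:ℝ))/2)) := by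
    refine integrable_rpow_neg_one_add_norm_sq ?_
    simp; linarith
  have h2 := (h1.mul_prod (integrableOn_rpow_mul_one_add_sq hs hβ hβs)).const_mul (C^2)
  refine h2.mono' ?_ ?_
  · exact ((((measurable_csExtDeriv hf.continuous.measurable).pow_const 2).mul
      (measurable_snd.pow_const _))).aestronglyMeasurable
  · have hpos : ∀ᵐ z : EuclideanSpace ℝ (Fin n) × ℝ ∂(volume.prod (volume.restrict (Ioi 0))),
        0 < z.2 :=
      Measure.quasiMeasurePreserving_snd.ae (self_mem_ae_restrict measurableSet_Ioi)
    filter_upwards [hpos] with ⟨x, t⟩ ht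
    simp only at ht ⊢
    rw [Real.norm_of_nonneg (by positivity), ← sq_abs]
    have hP : ∀ a : ℝ, 0 < a → ∀ b : ℝ, (a ^ b)^2 = a ^ (2 * b) := fun a ha b => by
      rw [← Real.rpow_natCast, ← Real.rpow_mul ha.le, mul_comm]; norm_num
    calc |csExtDeriv n s f x t|^2 * t ^ (1 - β)
        ≤ (C * t ^ (s - 1) * (1 + (‖x‖^2 + t^2)) ^ (-((n:ℝ) + s)/2))^2 * t ^ (1 - β) := by
          gcongr; exact hC x t ht
      _ = C^2 * ((1 + (‖x‖^2 + t^2)) ^ (-(n:ℝ)) * (1 + (‖x‖^2 + t^2)) ^ (-s) *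
            t ^ (2 * s - 1 - β)) := by
          rw [mul_pow, mul_pow, hP _ ht, hP _ (by positivity), ← Real.rpow_add (by positivity),
            show 2 * s - 1 - β = 2 * (s - 1) + (1 - β) by ring, Real.rpow_add ht,
            show 2 * (-((n:ℝ) + s)/2) = -n + -s by ring]
          ring
      _ ≤ C^2 * ((1 + ‖x‖^2) ^ (-(n:ℝ)) * (1 + t^2) ^ (-s) * t ^ (2 * s - 1 - β)) := by
          gcongr ?_ * (?_ * ?_ * ?_)
          · exact Real.rpow_le_rpow_of_nonpos (by positivity) (by nlinarith) (by linarith)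
          · exact Real.rpow_le_rpow_of_nonpos (by positivity) (by nlinarith) (by linarith)
      _ = _ := by rw [show -(2 * (n:ℝ))/2 = -n by ring]; ring

lemma tEnergy_nonneg (n : ℕ) (s β : ℝ) (f : EuclideanSpace ℝ (Fin n) → ℝ) :
    0 ≤ tEnergy n s β f :=
  setIntegral_nonneg (measurableSet_lt measurable_const measurable_snd) fun z (hz : 0 < z.2) => by
    positivity

/-- The energy as an iterated lower Lebesgue integral. -/
lemma ofReal_tEnergy {β : ℝ} (hn : 1 ≤ n) (hs : 0 < s) (hs2 : s < 2)
    (hβ : 0 < β) (hβs : β < 2 * s)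
    (hf : ContDiff ℝ (⊤ : ℕ∞) f) (hc : HasCompactSupport f) :
    ENNReal.ofReal (tEnergy n s β f) = ∫⁻ t in Ioi (0:ℝ),
      (∫⁻ y, ‖csExtDeriv n s f y t‖ₑ^2) * ENNReal.ofReal (t ^ (1 - β)) := by
  obtain ⟨M, hM⟩ := hc.exists_bound_of_continuous hf.continuous
  have hi := integrable_csExtDeriv_sq hn hs hs2 hβ hβs hf hc
  have hme := measurable_csExtDeriv (s := s) hf.continuous.measurable
  have hset : {z : EuclideanSpace ℝ (Fin n) × ℝ | 0 < z.2} = univ ×ˢ Ioi 0 := by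
    ext; simp
  have hmeas : (volume : Measure (EuclideanSpace ℝ (Fin n) × ℝ)).restrict
      {z : EuclideanSpace ℝ (Fin n) × ℝ | 0 < z.2} = volume.prod (volume.restrict (Ioi 0)) := by
    rw [hset, Measure.volume_eq_prod, ← Measure.prod_restrict, Measure.restrict_univ]
  have hpos : ∀ᵐ z : EuclideanSpace ℝ (Fin n) × ℝ ∂(volume.prod (volume.restrict (Ioi 0))),
      0 < z.2 :=
    Measure.quasiMeasurePreserving_snd.ae (self_mem_ae_restrict measurableSet_Ioi)
  have e1 : tEnergy n s β f = ∫ z : EuclideanSpace ℝ (Fin n) × ℝ,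
      (csExtDeriv n s f z.1 z.2)^2 * z.2 ^ (1 - β) ∂(volume.prod (volume.restrict (Ioi 0))) := by
    rw [tEnergy, hmeas]
    refine integral_congr_ae ?_
    filter_upwards [hpos] with z hz
    have := (hasDerivAt_csExt hs hf.continuous.measurable hM z.1 hz).deriv
    simp only [this]
  rw [e1, ofReal_integral_eq_lintegral_ofReal hi, lintegral_prod_symm]
  · refine setLIntegral_congr_fun measurableSet_Ioi fun t ht => ?_
    have ht' : (0:ℝ) < t := ht
    simp only
    rw [← lintegral_mul_const]
    · refine lintegral_congr fun y => ?_
      rw [ENNReal.ofReal_mul (sq_nonneg _), ← sq_abs, ENNReal.ofReal_pow (abs_nonneg _),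
        ← Real.enorm_eq_ofReal_abs]
    · exact ((hme.comp (measurable_id.prodMk measurable_const)).enorm.pow_const 2)
  · exact hi.aestronglyMeasurable.aemeasurable.ennreal_ofReal
  · filter_upwards [hpos] with z hz
    simp only [Pi.zero_apply]
    positivity

end

end

section

open Filter Topology

lemma sq_lintegral_mul_le {α : Type*} [MeasurableSpace α] (μ : Measure α) {f g : α → ℝ≥0∞}
    (hf : AEMeasurable f μ) (hg : AEMeasurable g μ) :
    (∫⁻ a, f a * g a ∂μ) ^ 2 ≤ (∫⁻ a, f a ^ 2 ∂μ) * ∫⁻ a, g a ^ 2 ∂μ := by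
  have h := ENNReal.lintegral_mul_le_Lp_mul_Lq μ Real.HolderConjugate.two_two hf hg
  have e : ∀ c : ℝ≥0∞, (c ^ (1/2:ℝ)) ^ 2 = c := fun c => by
    rw [← ENNReal.rpow_natCast, ← ENNReal.rpow_mul]; norm_num
  calc _ ≤ ((∫⁻ a, f a ^ (2:ℝ) ∂μ) ^ (1/2:ℝ) * (∫⁻ a, g a ^ (2:ℝ) ∂μ) ^ (1/2:ℝ)) ^ 2 := by
        gcongr; exact h
    _ = _ := by rw [mul_pow, e, e]; simp

lemma ennreal_add_sq_le (a b : ℝ≥0∞) : (a + b) ^ 2 ≤ 2 * (a ^ 2 + b ^ 2) := by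
  have h := ENNReal.rpow_add_le_mul_rpow_add_rpow a b (p := 2) one_le_two
  norm_num at h
  exact h

/-- Cauchy–Schwarz on a set of positive times with a power weight. -/
lemma sq_setLIntegral_le_rpow {S : Set ℝ} (hS : MeasurableSet S) (hS0 : S ⊆ Ioi 0)
    {a : ℝ → ℝ≥0∞} (ha : Measurable a) (p : ℝ) :
    (∫⁻ t in S, a t) ^ 2 ≤
      (∫⁻ t in S, a t ^ 2 * ENNReal.ofReal (t ^ p)) * ∫⁻ t in S, ENNReal.ofReal (t ^ (-p)) := by
  have h := sq_lintegral_mul_le (volume.restrict S)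
    (f := fun t => a t * ENNReal.ofReal (t ^ (p/2))) (g := fun t => ENNReal.ofReal (t ^ (-p/2)))
    (Measurable.aemeasurable (by fun_prop)) (Measurable.aemeasurable (by fun_prop))
  have hP : ∀ t : ℝ, 0 < t → ∀ b : ℝ, ENNReal.ofReal (t ^ (b/2)) ^ 2 = ENNReal.ofReal (t ^ b) :=
    fun t ht b => by
      rw [← ENNReal.ofReal_pow (by positivity), ← Real.rpow_natCast, ← Real.rpow_mul ht.le]
      norm_num
  convert h using 1
  · congr 1
    refine setLIntegral_congr_fun hS fun t ht => ?_
    have ht0 : 0 < t := hS0 ht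
    rw [mul_assoc, ← ENNReal.ofReal_mul (by positivity), ← Real.rpow_add ht0, neg_div,
      add_neg_cancel, Real.rpow_zero, ENNReal.ofReal_one, mul_one]
  · congr 1
    · refine setLIntegral_congr_fun hS fun t ht => ?_
      rw [mul_pow, hP t (hS0 ht)]
    · refine setLIntegral_congr_fun hS fun t ht => ?_
      rw [hP t (hS0 ht)]

lemma lintegral_Ioc_rpow {b T : ℝ} (hb : 0 < b) (hT : 0 < T) :
    ∫⁻ t in Ioc 0 T, ENNReal.ofReal (t ^ (b - 1)) = ENNReal.ofReal (T ^ b / b) := by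
  have hi : IntegrableOn (fun t : ℝ => t ^ (b - 1)) (Ioc 0 T) :=
    (intervalIntegral.intervalIntegrable_rpow' (by linarith)).1
  rw [← ofReal_integral_eq_lintegral_ofReal hi]
  · rw [← intervalIntegral.integral_of_le hT.le, integral_rpow (Or.inl (by linarith))]
    simp [Real.zero_rpow hb.ne']
  · filter_upwards [self_mem_ae_restrict measurableSet_Ioc] with t ht
    exact Real.rpow_nonneg ht.1.le _

lemma lintegral_Ioi_rpow {d T : ℝ} (hd : 0 < d) (hT : 0 < T) :
    ∫⁻ t in Ioi T, ENNReal.ofReal (t ^ (-(1 + d))) = ENNReal.ofReal (T ^ (-d) / d) := by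
  have hi := integrableOn_Ioi_rpow_of_lt (a := -(1 + d)) (c := T) (by linarith) hT
  rw [← ofReal_integral_eq_lintegral_ofReal hi]
  · rw [integral_Ioi_rpow_of_lt (by linarith) hT]
    congr 1
    rw [show -(1 + d) + 1 = -d by ring, neg_div_neg_eq]
  · filter_upwards [self_mem_ae_restrict measurableSet_Ioi] with t ht
    exact Real.rpow_nonneg (hT.trans ht).le _

/-- The Gaussian average of `V · t` at scale `t` around `x`. -/
def gaussAvg (n : ℕ) (V : EuclideanSpace ℝ (Fin n) → ℝ → ℝ≥0∞) (x : EuclideanSpace ℝ (Fin n))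
    (t : ℝ) : ℝ≥0∞ :=
  ∫⁻ y, V y t * ENNReal.ofReal (gaussKer n (t^2) (x - y))

section
variable {n : ℕ} {V : EuclideanSpace ℝ (Fin n) → ℝ → ℝ≥0∞}

lemma measurable_gaussAvg (hV : Measurable (Function.uncurry V)) :
    Measurable (Function.uncurry (gaussAvg n V)) := by
  have hk : Measurable (fun q : (EuclideanSpace ℝ (Fin n) × ℝ) × EuclideanSpace ℝ (Fin n) =>
      gaussKer n (q.1.2^2) (q.1.1 - q.2)) :=
    (measurable_gaussKer n).comp (by fun_prop :
      Measurable (fun q : (EuclideanSpace ℝ (Fin n) × ℝ) × EuclideanSpace ℝ (Fin n) =>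
        (q.1.2^2, q.1.1 - q.2)))
  have hv : Measurable (fun q : (EuclideanSpace ℝ (Fin n) × ℝ) × EuclideanSpace ℝ (Fin n) =>
      V q.2 q.1.2) := hV.comp (by fun_prop :
      Measurable (fun q : (EuclideanSpace ℝ (Fin n) × ℝ) × EuclideanSpace ℝ (Fin n) =>
        (q.2, q.1.2)))
  exact (hv.mul hk.ennreal_ofReal).lintegral_prod_right'

lemma lintegral_gaussKer_sub_left {a : ℝ} (ha : 0 < a) (x : EuclideanSpace ℝ (Fin n)) :
    ∫⁻ y, ENNReal.ofReal (gaussKer n a (x - y)) = 1 := by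
  rw [lintegral_sub_left_eq_self (fun y => ENNReal.ofReal (gaussKer n a y)) x,
    ← ofReal_integral_eq_lintegral_ofReal (integrable_gaussKer ha)
      (Eventually.of_forall (gaussKer_nonneg ha.le)), integral_gaussKer ha, ENNReal.ofReal_one]

lemma lintegral_gaussKer_sub_right {a : ℝ} (ha : 0 < a) (y : EuclideanSpace ℝ (Fin n)) :
    ∫⁻ x, ENNReal.ofReal (gaussKer n a (x - y)) = 1 := by
  rw [lintegral_sub_right_eq_self (fun y => ENNReal.ofReal (gaussKer n a y)) y,
    ← ofReal_integral_eq_lintegral_ofReal (integrable_gaussKer ha)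
      (Eventually.of_forall (gaussKer_nonneg ha.le)), integral_gaussKer ha, ENNReal.ofReal_one]

lemma gaussAvg_sq_le (hV : Measurable (Function.uncurry V)) (x : EuclideanSpace ℝ (Fin n)) {t : ℝ}
    (ht : 0 < t) : gaussAvg n V x t ^ 2 ≤ gaussAvg n (fun y t => V y t ^ 2) x t := by
  have hv : Measurable (fun y => V y t) := hV.comp (measurable_id.prodMk measurable_const)
  have hk : Measurable (fun y => ENNReal.ofReal (√(gaussKer n (t^2) (x - y)))) := by
    have := (continuous_gaussKer n (t^2)).measurable
    fun_prop
  have hk2 : ∀ y, ENNReal.ofReal (√(gaussKer n (t^2) (x - y))) ^ 2 =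
      ENNReal.ofReal (gaussKer n (t^2) (x - y)) := fun y => by
    rw [← ENNReal.ofReal_pow (Real.sqrt_nonneg _), Real.sq_sqrt (gaussKer_nonneg (sq_nonneg _) _)]
  have h := sq_lintegral_mul_le volume (hv.mul hk).aemeasurable hk.aemeasurable
  simp only [Pi.mul_apply, mul_pow, hk2, lintegral_gaussKer_sub_left (pow_pos ht 2), mul_one,
    mul_assoc, ← sq] at h
  exact h

lemma gaussAvg_le (x : EuclideanSpace ℝ (Fin n)) {t : ℝ} (ht : 0 < t) :
    gaussAvg n V x t ≤ ENNReal.ofReal (π ^ (-(n:ℝ)/2) * t ^ (-(n:ℝ))) * ∫⁻ y, V y t := by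
  rw [← lintegral_const_mul' _ _ ENNReal.ofReal_ne_top]
  refine lintegral_mono fun y => ?_
  rw [mul_comm]
  gcongr
  refine (gaussKer_le (by positivity) _).trans_eq ?_
  rw [Real.mul_rpow (by positivity) (by positivity), ← Real.rpow_natCast t 2, ← Real.rpow_mul ht.le]
  congr 2; push_cast; ring

lemma lintegral_gaussAvg (hV : Measurable (Function.uncurry V)) {t : ℝ} (ht : 0 < t) :
    ∫⁻ x, gaussAvg n V x t = ∫⁻ y, V y t := by
  have hv : Measurable (fun y => V y t) := hV.comp (measurable_id.prodMk measurable_const)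
  have hk := (continuous_gaussKer n (t^2)).measurable
  unfold gaussAvg
  rw [lintegral_lintegral_swap (by fun_prop)]
  refine lintegral_congr fun y => ?_
  rw [lintegral_const_mul _ (by fun_prop), lintegral_gaussKer_sub_right (pow_pos ht 2), mul_one]

/-- The contribution of small times. -/
lemma sq_setLIntegral_Ioc_gaussAvg_le (hV : Measurable (Function.uncurry V)) {β T : ℝ} (hβ : 0 < β)
    (hT : 0 < T) (x : EuclideanSpace ℝ (Fin n)) :
    (∫⁻ t in Ioc 0 T, gaussAvg n V x t) ^ 2 ≤
      (∫⁻ t in Ioi (0:ℝ), gaussAvg n (fun y t => V y t ^ 2) x t * ENNReal.ofReal (t ^ (1 - β))) *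
        ENNReal.ofReal (T ^ β / β) := by
  have hm : Measurable (gaussAvg n V x) := (measurable_gaussAvg hV).comp measurable_prodMk_left
  refine (sq_setLIntegral_le_rpow measurableSet_Ioc Ioc_subset_Ioi_self hm (1 - β)).trans ?_
  rw [neg_sub, lintegral_Ioc_rpow hβ hT]
  refine mul_le_mul' ?_ le_rfl
  refine (lintegral_mono_set Ioc_subset_Ioi_self).trans
    (setLIntegral_mono' measurableSet_Ioi fun t ht => ?_)
  gcongr
  exact gaussAvg_sq_le hV x ht

/-- The contribution of large times. -/
lemma sq_setLIntegral_Ioi_gaussAvg_le (hV : Measurable (Function.uncurry V)) {d T : ℝ} (hd : 0 < d)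
    (hT : 0 < T) (x : EuclideanSpace ℝ (Fin n)) :
    (∫⁻ t in Ioi T, gaussAvg n V x t) ^ 2 ≤ ENNReal.ofReal (π ^ (-(n:ℝ)/2)) *
      (∫⁻ t in Ioi T, (∫⁻ y, V y t ^ 2) * ENNReal.ofReal (t ^ (1 + d - n))) *
        ENNReal.ofReal (T ^ (-d) / d) := by
  have hm : Measurable (gaussAvg n V x) := (measurable_gaussAvg hV).comp measurable_prodMk_left
  refine (sq_setLIntegral_le_rpow measurableSet_Ioi (Ioi_subset_Ioi hT.le) hm (1 + d)).trans ?_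
  rw [lintegral_Ioi_rpow hd hT, ← lintegral_const_mul' _ _ ENNReal.ofReal_ne_top]
  refine mul_le_mul' ?_ le_rfl
  refine setLIntegral_mono' measurableSet_Ioi fun t ht => ?_
  have ht0 : 0 < t := hT.trans ht
  calc _ ≤ (ENNReal.ofReal (π ^ (-(n:ℝ)/2) * t ^ (-(n:ℝ))) * ∫⁻ y, V y t ^ 2) *
        ENNReal.ofReal (t ^ (1 + d)) := by
        gcongr
        exact (gaussAvg_sq_le hV x ht0).trans (gaussAvg_le x ht0)
    _ = _ := by
        rw [sub_eq_add_neg (1 + d), Real.rpow_add ht0 (1 + d), ENNReal.ofReal_mul (by positivity),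
          ENNReal.ofReal_mul (by positivity)]
        ring

lemma sq_setLIntegral_gaussAvg_le (hV : Measurable (Function.uncurry V)) {β d T : ℝ} (hβ : 0 < β)
    (hd : 0 < d) (hT : 0 < T) (x : EuclideanSpace ℝ (Fin n)) :
    (∫⁻ t in Ioi 0, gaussAvg n V x t) ^ 2 ≤ 2 * (
      (∫⁻ t in Ioi (0:ℝ), gaussAvg n (fun y t => V y t ^ 2) x t * ENNReal.ofReal (t ^ (1 - β))) *
        ENNReal.ofReal (T ^ β / β) + ENNReal.ofReal (π ^ (-(n:ℝ)/2)) *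
      (∫⁻ t in Ioi T, (∫⁻ y, V y t ^ 2) * ENNReal.ofReal (t ^ (1 + d - n))) *
        ENNReal.ofReal (T ^ (-d) / d)) := by
  rw [← Ioc_union_Ioi_eq_Ioi hT.le, lintegral_union measurableSet_Ioi
    (Ioc_disjoint_Ioi le_rfl), Ioc_union_Ioi_eq_Ioi hT.le]
  exact (ennreal_add_sq_le _ _).trans (mul_le_mul' le_rfl
    (add_le_add (sq_setLIntegral_Ioc_gaussAvg_le hV hβ hT x)
      (sq_setLIntegral_Ioi_gaussAvg_le hV hd hT x)))

lemma lintegral_setLIntegral_gaussAvg (hV : Measurable (Function.uncurry V)) (β : ℝ) :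
    ∫⁻ x, ∫⁻ t in Ioi (0:ℝ), gaussAvg n V x t * ENNReal.ofReal (t ^ (1 - β)) =
      ∫⁻ t in Ioi (0:ℝ), (∫⁻ y, V y t) * ENNReal.ofReal (t ^ (1 - β)) := by
  have hm := measurable_gaussAvg hV
  rw [lintegral_lintegral_swap]
  · refine setLIntegral_congr_fun measurableSet_Ioi fun t ht => ?_
    have hm' : Measurable (fun x => gaussAvg n V x t) := hm.comp measurable_prodMk_right
    rw [lintegral_mul_const _ hm', lintegral_gaussAvg hV ht]
  · exact (hm.mul (by fun_prop)).aemeasurable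

end

end

section

open Filter Topology

/-- Optimization of a two-sided power bound over the splitting parameter. -/
lemma rpow_le_of_forall_le_add {a K g e ν β : ℝ} (ha : 0 ≤ a) (hK : 0 ≤ K) (hg : 0 ≤ g)
    (he : 0 ≤ e) (hβ : 0 < β) (hβν : β < ν)
    (h : ∀ T, 0 < T → a ≤ K * (g * T ^ β + e * T ^ (β - ν))) :
    a ^ (ν / (ν - β)) ≤ (2 * K) ^ (ν / (ν - β)) * e ^ (β / (ν - β)) * g := by
  have hν : 0 < ν := hβ.trans hβν
  have hd : 0 < ν - β := sub_pos.2 hβν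
  have hq : 0 < ν / (ν - β) := by positivity
  have hzero : a ≤ 0 → a ^ (ν / (ν - β)) ≤ (2 * K) ^ (ν / (ν - β)) * e ^ (β / (ν - β)) * g := by
    intro h0
    rw [le_antisymm h0 ha, Real.zero_rpow hq.ne']
    positivity
  rcases hg.eq_or_lt with rfl | hg0
  · apply hzero
    have hlim : Tendsto (fun T : ℝ => K * (e * T ^ (-(ν - β)))) atTop (𝓝 (K * (e * 0))) :=
      ((tendsto_rpow_neg_atTop hd).const_mul e).const_mul K
    rw [mul_zero, mul_zero] at hlim
    refine ge_of_tendsto hlim ?_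
    filter_upwards [eventually_gt_atTop 0] with T hT
    simpa using h T hT
  rcases he.eq_or_lt with rfl | he0
  · apply hzero
    have hlim : Tendsto (fun T : ℝ => K * (g * T ^ (-β))) atTop (𝓝 (K * (g * 0))) :=
      ((tendsto_rpow_neg_atTop hβ).const_mul g).const_mul K
    rw [mul_zero, mul_zero] at hlim
    refine ge_of_tendsto hlim ?_
    filter_upwards [eventually_gt_atTop 0] with T hT
    have := h T⁻¹ (inv_pos.2 hT)
    rw [Real.inv_rpow hT.le, ← Real.rpow_neg hT.le] at this
    simpa using this
  have h1 := h ((e / g) ^ (1 / ν)) (by positivity)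
  have e1 : g * ((e / g) ^ (1 / ν)) ^ β = g ^ ((ν - β) / ν) * e ^ (β / ν) := by
    rw [← Real.rpow_mul (by positivity), Real.div_rpow he hg, one_div_mul_eq_div,
      sub_div, div_self hν.ne', Real.rpow_sub hg0, Real.rpow_one]
    ring
  have e2 : e * ((e / g) ^ (1 / ν)) ^ (β - ν) = g ^ ((ν - β) / ν) * e ^ (β / ν) := by
    rw [← Real.rpow_mul (by positivity), Real.div_rpow he hg, one_div_mul_eq_div,
      show (ν - β) / ν = -((β - ν) / ν) by ring, Real.rpow_neg hg,
      show β / ν = (β - ν) / ν + 1 by field_simp; ring, Real.rpow_add_one he0.ne']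
    ring
  rw [e1, e2] at h1
  calc a ^ (ν / (ν - β)) ≤ (2 * K * (g ^ ((ν - β) / ν) * e ^ (β / ν))) ^ (ν / (ν - β)) :=
        Real.rpow_le_rpow ha (by linarith) hq.le
    _ = _ := by
        rw [Real.mul_rpow (by positivity) (by positivity),
          Real.mul_rpow (x := g ^ _) (by positivity) (by positivity), ← Real.rpow_mul hg, ←
              Real.rpow_mul he,
          show (ν - β) / ν * (ν / (ν - β)) = 1 by field_simp,
          show β / ν * (ν / (ν - β)) = β / (ν - β) by field_simp, Real.rpow_one]
        ring

lemma integral_le_of_lintegral_ofReal_le {α : Type*} [MeasurableSpace α] {μ : Measure α}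
    {f : α → ℝ} (hf0 : 0 ≤ f) (hf : AEStronglyMeasurable f μ) {C : ℝ} (hC : 0 ≤ C)
    (h : ∫⁻ a, ENNReal.ofReal (f a) ∂μ ≤ ENNReal.ofReal C) : ∫ a, f a ∂μ ≤ C := by
  rw [integral_eq_lintegral_of_nonneg_ae (Eventually.of_forall hf0) hf]
  exact ENNReal.toReal_le_of_le_ofReal hC h

section
variable {n : ℕ} {s β : ℝ} {f : EuclideanSpace ℝ (Fin n) → ℝ}

lemma measurable_setLIntegral_gaussAvg {V : EuclideanSpace ℝ (Fin n) → ℝ → ℝ≥0∞}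
    (hV : Measurable (Function.uncurry V)) (β : ℝ) :
    Measurable fun x => ∫⁻ t in Ioi (0:ℝ), gaussAvg n V x t * ENNReal.ofReal (t ^ (1 - β)) := by
  have h : Measurable (fun p : EuclideanSpace ℝ (Fin n) × ℝ => ENNReal.ofReal (p.2 ^ (1 - β))) := by
    fun_prop
  exact ((measurable_gaussAvg hV).mul h).lintegral_prod_right'

lemma measurable_enorm_csExtDeriv (hf : Measurable f) :
    Measurable (Function.uncurry fun y t => ‖csExtDeriv n s f y t‖ₑ) :=
  (measurable_csExtDeriv hf).enorm

lemma ofReal_sq_le_sq_setLIntegral_gaussAvg (hn : 1 ≤ n) (hs : 0 < s)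
    (hf : ContDiff ℝ (⊤ : ℕ∞) f) (hc : HasCompactSupport f) (x : EuclideanSpace ℝ (Fin n)) :
    ENNReal.ofReal (reproConst s ^ 2 * f x ^ 2) ≤
      (∫⁻ t in Ioi 0, gaussAvg n (fun y t => ‖csExtDeriv n s f y t‖ₑ) x t) ^ 2 := by
  obtain ⟨M, hM⟩ := hc.exists_bound_of_continuous hf.continuous
  have hr := reproConst_pos hs
  rw [← sq_abs (f x), ← mul_pow, ENNReal.ofReal_pow (by positivity)]
  gcongr
  exact reproConst_mul_abs_le hn hs hf.continuous (hf.continuous.integrable_of_hasCompactSupport hc)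
    hM x

lemma integral_rpow_le_tEnergy (hn : 1 ≤ n) (hs : 0 < s) (hs2 : s < 2) (hβ : 0 < β)
    (hβn : β < n) (hβs : β < 2 * s) (hf : ContDiff ℝ (⊤ : ℕ∞) f) (hc : HasCompactSupport f) :
    ∫ x, |f x| ^ (2 * (n:ℝ) / (n - β)) ≤
      (4 * (1 / β + π ^ (-(n:ℝ)/2) / (n - β)) / reproConst s ^ 2 * tEnergy n s β f) ^
        ((n:ℝ) / (n - β)) := by
  have hr := reproConst_pos hs
  have hd : 0 < (n:ℝ) - β := sub_pos.2 hβn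
  have hn0 : (0:ℝ) < n := hβ.trans hβn
  set V : EuclideanSpace ℝ (Fin n) → ℝ → ℝ≥0∞ := fun y t => ‖csExtDeriv n s f y t‖ₑ with hVdef
  have hV : Measurable (Function.uncurry V) := measurable_enorm_csExtDeriv hf.continuous.measurable
  have hV2 : Measurable (Function.uncurry fun y t => V y t ^ 2) := hV.pow_const 2
  set e := tEnergy n s β f with he
  have he0 : 0 ≤ e := tEnergy_nonneg n s β f
  have hE : ENNReal.ofReal e = ∫⁻ t in Ioi (0:ℝ), (∫⁻ y, V y t ^ 2) * ENNReal.ofReal (t ^ (1 - β))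
      :=
    ofReal_tEnergy hn hs hs2 hβ hβs hf hc
  set G : EuclideanSpace ℝ (Fin n) → ℝ≥0∞ := fun x =>
    ∫⁻ t in Ioi (0:ℝ), gaussAvg n (fun y t => V y t ^ 2) x t * ENNReal.ofReal (t ^ (1 - β)) with hG
  have hGm : Measurable G :=
    measurable_setLIntegral_gaussAvg hV2 β
  have hGi : ∫⁻ x, G x = ENNReal.ofReal e := by
    rw [hE]; exact lintegral_setLIntegral_gaussAvg hV2 β
  have hGfin : ∀ᵐ x, G x < ∞ := ae_lt_top hGm (by rw [hGi]; exact ENNReal.ofReal_ne_top)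
  set K : ℝ := 2 * (1 / β + π ^ (-(n:ℝ)/2) / (n - β)) with hK
  have hK0 : 0 < K := by positivity
  set q : ℝ := (n:ℝ) / (n - β) with hq
  have hq0 : 0 < q := by positivity
  have hpt : ∀ᵐ x, ENNReal.ofReal ((reproConst s ^ 2 * f x ^ 2) ^ q) ≤
      ENNReal.ofReal ((2 * K) ^ q * e ^ (β / (n - β))) * G x := by
    filter_upwards [hGfin] with x hx
    rw [← ENNReal.ofReal_toReal hx.ne, ← ENNReal.ofReal_mul (by positivity)]
    refine ENNReal.ofReal_le_ofReal ?_
    have hg0 : 0 ≤ (G x).toReal := ENNReal.toReal_nonneg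
    refine rpow_le_of_forall_le_add (by positivity) hK0.le hg0 he0 hβ hβn fun T hT => ?_
    have h1 := (ofReal_sq_le_sq_setLIntegral_gaussAvg hn hs hf hc x).trans
      (sq_setLIntegral_gaussAvg_le hV hβ hd hT x)
    have h2 : ∫⁻ t in Ioi T, (∫⁻ y, V y t ^ 2) * ENNReal.ofReal (t ^ (1 + (n - β) - n)) ≤
        ENNReal.ofReal e := by
      rw [hE, show 1 + ((n:ℝ) - β) - n = 1 - β by ring]
      exact lintegral_mono_set (Ioi_subset_Ioi hT.le)
    have h3 : ENNReal.ofReal (reproConst s ^ 2 * f x ^ 2) ≤ ENNReal.ofReal (2 *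
        ((G x).toReal * (T ^ β / β) + π ^ (-(n:ℝ)/2) * e * (T ^ (-((n:ℝ) - β)) / (n - β)))) := by
      refine h1.trans ?_
      rw [ENNReal.ofReal_mul zero_le_two, ENNReal.ofReal_add (by positivity) (by positivity),
        ENNReal.ofReal_mul hg0, ENNReal.ofReal_toReal hx.ne, ENNReal.ofReal_mul (by positivity),
        ENNReal.ofReal_mul (by positivity), ENNReal.ofReal_ofNat]
      exact mul_le_mul' le_rfl (add_le_add le_rfl (mul_le_mul' (mul_le_mul' le_rfl h2) le_rfl))
    rw [ENNReal.ofReal_le_ofReal_iff (by positivity), neg_sub] at h3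
    refine h3.trans ?_
    have a1 : 0 ≤ (G x).toReal * T ^ β * (π ^ (-(n:ℝ)/2) / (n - β)) := by positivity
    have a2 : 0 ≤ e * T ^ (β - n) * (1 / β) := by positivity
    have a3 : K * ((G x).toReal * T ^ β + e * T ^ (β - n)) = 2 *
        ((G x).toReal * (T ^ β / β) + π ^ (-(n:ℝ)/2) * e * (T ^ (β - n) / (n - β))) +
        2 * ((G x).toReal * T ^ β * (π ^ (-(n:ℝ)/2) / (n - β)) + e * T ^ (β - n) * (1 / β)) := by
      rw [hK]; ring
    linarith
  have hle_int : ∫⁻ x, ENNReal.ofReal ((reproConst s ^ 2 * f x ^ 2) ^ q) ≤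
      ENNReal.ofReal ((2 * K * e) ^ q) := by
    refine (lintegral_mono_ae hpt).trans_eq ?_
    rw [lintegral_const_mul _ hGm, hGi, ← ENNReal.ofReal_mul (by positivity), mul_assoc,
      Real.mul_rpow (by positivity) he0]
    have hq1 : q = β / (n - β) + 1 := by rw [hq]; field_simp; ring
    rw [← Real.rpow_add_one' he0 (hq1 ▸ hq0.ne'), ← hq1]
  have hcont := hf.continuous
  have hreal := integral_le_of_lintegral_ofReal_le (fun x => by positivity)
    (Measurable.aestronglyMeasurable (by fun_prop)) (by positivity) hle_int
  have hfun : (fun x => |f x| ^ (2 * (n:ℝ) / (n - β))) =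
      fun x => ((reproConst s ^ 2) ^ q)⁻¹ * (reproConst s ^ 2 * f x ^ 2) ^ q := by
    ext x
    rw [Real.mul_rpow (by positivity) (by positivity), inv_mul_cancel_left₀ (by positivity),
      ← sq_abs (f x), ← Real.rpow_natCast |f x|, ← Real.rpow_mul (abs_nonneg _)]
    congr 1; rw [hq]; push_cast; ring
  rw [hfun, integral_const_mul]
  calc _ ≤ ((reproConst s ^ 2) ^ q)⁻¹ * (2 * K * e) ^ q := by gcongr
    _ = _ := by
      rw [← Real.inv_rpow (by positivity), ← Real.mul_rpow (by positivity) (by positivity)]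
      congr 1; rw [hK]; ring

lemma mul_log_sq_le {ν β Q : ℝ} (hβν : β < ν) (hν : 0 < ν) (hQ : 0 < Q) (y : ℝ) :
    β / (ν - β) * (y ^ 2 * log (y ^ 2)) ≤
      Q⁻¹ * |y| ^ (2 * ν / (ν - β)) + (log Q - 1) * y ^ 2 := by
  have hd : 0 < ν - β := sub_pos.2 hβν
  rcases eq_or_ne y 0 with rfl | h0
  · have hq0 : 2 * ν / (ν - β) ≠ 0 := by positivity
    simp [Real.zero_rpow hq0]
  have hp : 0 < |y| := abs_pos.2 h0
  have hr : |y| ^ (2 * ν / (ν - β)) = y ^ 2 * (y ^ 2) ^ (β / (ν - β)) := by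
    rw [← sq_abs y, ← Real.rpow_natCast |y|, ← Real.rpow_mul hp.le, ← Real.rpow_add hp]
    congr 1; push_cast; field_simp; ring
  have hl := Real.log_le_sub_one_of_pos (x := (y ^ 2) ^ (β / (ν - β)) / Q) (by positivity)
  rw [Real.log_div (by positivity) hQ.ne', Real.log_rpow (by positivity)] at hl
  rw [hr]
  calc _ = y ^ 2 * (β / (ν - β) * log (y ^ 2)) := by ring
    _ ≤ y ^ 2 * ((y ^ 2) ^ (β / (ν - β)) / Q - 1 + log Q) := by gcongr; linarith
    _ = _ := by ring

/-- The logarithmic Sobolev functional is controlled by an `L^q` norm, by Jensen's inequality. -/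
lemma exp_integral_mul_log_le (hβ : 0 < β) (hβn : β < n) (hf : Continuous f)
    (hc : HasCompactSupport f) (h1 : ∫ x, f x ^ 2 = 1) :
    rexp (β / n * ∫ x, f x ^ 2 * log (f x ^ 2)) ≤
      (∫ x, |f x| ^ (2 * (n:ℝ) / (n - β))) ^ (((n:ℝ) - β) / n) := by
  have hd : 0 < (n:ℝ) - β := sub_pos.2 hβn
  have hn0 : (0:ℝ) < n := hβ.trans hβn
  obtain ⟨q, hq⟩ : ∃ q : ℝ, q = 2 * (n:ℝ) / (n - β) := ⟨_, rfl⟩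
  have hq0 : 0 < q := by rw [hq]; positivity
  rw [← hq]
  have c1 : Continuous fun x => f x ^ 2 := hf.pow 2
  have c3 : Continuous fun x => f x ^ 2 * log (f x ^ 2) := Real.continuous_mul_log.comp c1
  have i1 : Integrable (fun x => f x ^ 2) :=
    c1.integrable_of_hasCompactSupport (hc.mono' fun x hx => subset_tsupport _ fun h => hx
        (by simp [h]))
  have i2 : Integrable (fun x => |f x| ^ q) :=
    (hf.abs.rpow_const fun _ => Or.inr hq0.le).integrable_of_hasCompactSupport
      (hc.mono' fun x hx => subset_tsupport _ fun h => hx (by simp [h, Real.zero_rpow hq0.ne']))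
  have i3 : Integrable (fun x => f x ^ 2 * log (f x ^ 2)) :=
    c3.integrable_of_hasCompactSupport (hc.mono' fun x hx => subset_tsupport _ fun h => hx
        (by simp [h]))
  obtain ⟨Q, hQ⟩ : ∃ Q : ℝ, Q = ∫ x, |f x| ^ q := ⟨_, rfl⟩
  rw [← hQ]
  have hQ0 : 0 < Q := by
    rw [hQ, integral_pos_iff_support_of_nonneg (fun x => by positivity) i2]
    have hs : (Function.support fun x => |f x| ^ q) = Function.support fun x => f x ^ 2 := by
      ext x
      simp [Real.rpow_eq_zero_iff_of_nonneg (abs_nonneg (f x)), hq0.ne']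
    rw [hs, ← integral_pos_iff_support_of_nonneg (fun x => by positivity) i1, h1]
    exact one_pos
  have hpt : ∀ x, β / (n - β) * (f x ^ 2 * log (f x ^ 2)) ≤
      Q⁻¹ * |f x| ^ q + (log Q - 1) * f x ^ 2 := fun x => by
    rw [hq]; exact mul_log_sq_le hβn hn0 hQ0 (f x)
  have hle_int := integral_mono (i3.const_mul _) ((i2.const_mul _).add (i1.const_mul _)) hpt
  simp only [Pi.add_apply] at hle_int
  rw [integral_add (i2.const_mul _) (i1.const_mul _), integral_const_mul, integral_const_mul,
    integral_const_mul, h1, ← hQ, inv_mul_cancel₀ hQ0.ne'] at hle_int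
  rw [Real.rpow_def_of_pos hQ0, Real.exp_le_exp]
  calc _ = (β / (n - β) * ∫ x, f x ^ 2 * log (f x ^ 2)) * ((n - β) / n) := by field_simp
    _ ≤ _ := by gcongr; linarith

lemma lintegral_ball_rpow_norm (a : ℝ) {t : ℝ} (ht : 0 < t) :
    ∫⁻ x in ball (0 : EuclideanSpace ℝ (Fin n)) t, ENNReal.ofReal (‖x‖ ^ (-a)) =
      ENNReal.ofReal (t ^ ((n:ℝ) - a)) *
        ∫⁻ x in ball (0 : EuclideanSpace ℝ (Fin n)) 1, ENNReal.ofReal (‖x‖ ^ (-a)) := by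
  set h : EuclideanSpace ℝ (Fin n) → ℝ≥0∞ :=
    (ball 0 t).indicator fun x => ENNReal.ofReal (‖x‖ ^ (-a)) with hh
  have hm : Measurable h := Measurable.indicator (by fun_prop) measurableSet_ball
  have e1 := lintegral_map (μ := volume) hm (measurable_const_smul t)
  rw [Measure.map_addHaar_smul volume ht.ne', lintegral_smul_measure] at e1
  have e2 : ∀ x : EuclideanSpace ℝ (Fin n), h (t • x) = ENNReal.ofReal (t ^ (-a)) *
      (ball 0 1).indicator (fun x => ENNReal.ofReal (‖x‖ ^ (-a))) x := by
    intro x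
    have hmem : t • x ∈ ball (0 : EuclideanSpace ℝ (Fin n)) t ↔ x ∈ ball 0 1 := by
      rw [mem_ball_zero_iff, mem_ball_zero_iff, norm_smul, Real.norm_of_nonneg ht.le]
      exact mul_lt_iff_lt_one_right ht
    by_cases hx : x ∈ ball (0 : EuclideanSpace ℝ (Fin n)) 1
    · rw [hh, indicator_of_mem (hmem.2 hx), indicator_of_mem hx, norm_smul,
        Real.norm_of_nonneg ht.le, Real.mul_rpow ht.le (norm_nonneg _),
        ENNReal.ofReal_mul (by positivity)]
    · rw [hh, indicator_of_notMem (mt hmem.1 hx), indicator_of_notMem hx, mul_zero]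
  simp only [e2] at e1
  rw [lintegral_const_mul' _ _ ENNReal.ofReal_ne_top, lintegral_indicator measurableSet_ball,
    lintegral_indicator measurableSet_ball, finrank_euclideanSpace_fin, smul_eq_mul] at e1
  rw [sub_eq_add_neg, Real.rpow_add ht, ENNReal.ofReal_mul (by positivity), mul_assoc, ← e1,
    ← mul_assoc, ← ENNReal.ofReal_mul (by positivity), Real.rpow_natCast,
    abs_of_pos (by positivity), mul_inv_cancel₀ (by positivity), ENNReal.ofReal_one, one_mul]

lemma lintegral_ball_one_rpow_norm_lt_top (hn : 1 ≤ n) {a : ℝ} (ha : a < n) :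
    ∫⁻ x in ball (0 : EuclideanSpace ℝ (Fin n)) 1, ENNReal.ofReal (‖x‖ ^ (-a)) < ∞ := by
  have hi : IntegrableOn (fun x : EuclideanSpace ℝ (Fin n) => ‖x‖ ^ (-a)) (ball 0 1) := by
    refine integrableOn_ball_of_norm_le_rpow (C := 1) (α := a) (by simpa using hn)
        (by simpa using ha)
      (Eventually.of_forall fun x => ?_) (Measurable.aestronglyMeasurable (by fun_prop))
    rw [Real.norm_of_nonneg (by positivity), one_mul]
  exact hi.lintegral_lt_top

lemma lintegral_setLIntegral_Ioi_norm_mul {m : ℝ → ℝ≥0∞} (hm : Measurable m)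
    {w : EuclideanSpace ℝ (Fin n) → ℝ≥0∞} (hw : Measurable w) :
    ∫⁻ x, (∫⁻ t in Ioi ‖x‖, m t) * w x = ∫⁻ t in Ioi (0:ℝ), m t * ∫⁻ x in ball 0 t, w x := by
  set J : EuclideanSpace ℝ (Fin n) → ℝ → ℝ≥0∞ := fun x t => if ‖x‖ < t then m t * w x else 0 with hJ
  have hJm : Measurable (Function.uncurry J) :=
    Measurable.ite (measurableSet_lt (by fun_prop) measurable_snd) (by fun_prop) measurable_const
  have e1 : ∀ x, (∫⁻ t in Ioi ‖x‖, m t) * w x = ∫⁻ t in Ioi (0:ℝ), J x t := by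
    intro x
    rw [← lintegral_mul_const _ hm]
    have : J x = (Ioi ‖x‖).indicator fun t => m t * w x := by
      ext t
      by_cases ht : ‖x‖ < t <;> simp [hJ, ht]
    rw [this, setLIntegral_indicator measurableSet_Ioi,
      inter_eq_left.2 (Ioi_subset_Ioi (norm_nonneg x))]
  have e2 : ∀ t, m t * ∫⁻ x in ball 0 t, w x = ∫⁻ x, J x t := by
    intro t
    rw [← lintegral_const_mul _ hw, ← lintegral_indicator measurableSet_ball]
    refine lintegral_congr fun x => ?_
    by_cases hx : ‖x‖ < t <;> simp [hJ, hx]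
  simp_rw [e1, e2]
  exact lintegral_lintegral_swap hJm.aemeasurable

/-- The constant in the Hardy inequality. -/
def hardyConst (n : ℕ) (s β : ℝ) : ℝ :=
  (2 / β + 2 * π ^ (-(n:ℝ)/2) / (((n:ℝ) - β) / 2) *
    (∫⁻ x in ball (0 : EuclideanSpace ℝ (Fin n)) 1,
      ENNReal.ofReal (‖x‖ ^ (-(((n:ℝ) - β) / 2 + β)))).toReal) / reproConst s ^ 2

lemma hardyConst_pos (hs : 0 < s) (hβ : 0 < β) (hβn : β < n) : 0 < hardyConst n s β := by
  have hr := reproConst_pos hs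
  have hd : 0 < (n:ℝ) - β := sub_pos.2 hβn
  unfold hardyConst
  positivity

lemma integral_sq_div_norm_rpow_le_tEnergy (hn : 1 ≤ n) (hs : 0 < s) (hs2 : s < 2) (hβ : 0 < β)
    (hβn : β < n) (hβs : β < 2 * s) (hf : ContDiff ℝ (⊤ : ℕ∞) f) (hc : HasCompactSupport f) :
    ∫ x, f x ^ 2 / ‖x‖ ^ β ≤ hardyConst n s β * tEnergy n s β f := by
  have hr := reproConst_pos hs
  have hn0 : (0:ℝ) < n := hβ.trans hβn
  obtain ⟨d, hd⟩ : ∃ d : ℝ, d = ((n:ℝ) - β) / 2 := ⟨_, rfl⟩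
  have hd0 : 0 < d := by rw [hd]; linarith
  set V : EuclideanSpace ℝ (Fin n) → ℝ → ℝ≥0∞ := fun y t => ‖csExtDeriv n s f y t‖ₑ with hVdef
  have hV : Measurable (Function.uncurry V) := measurable_enorm_csExtDeriv hf.continuous.measurable
  have hV2 : Measurable (Function.uncurry fun y t => V y t ^ 2) := hV.pow_const 2
  have hVm : Measurable (fun t => ∫⁻ y, V y t ^ 2) := hV2.lintegral_prod_left'
  set e := tEnergy n s β f with he
  have he0 : 0 ≤ e := tEnergy_nonneg n s β f
  have hE : ENNReal.ofReal e = ∫⁻ t in Ioi (0:ℝ), (∫⁻ y, V y t ^ 2) * ENNReal.ofReal (t ^ (1 - β))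
      :=
    ofReal_tEnergy hn hs hs2 hβ hβs hf hc
  set G : EuclideanSpace ℝ (Fin n) → ℝ≥0∞ := fun x =>
    ∫⁻ t in Ioi (0:ℝ), gaussAvg n (fun y t => V y t ^ 2) x t * ENNReal.ofReal (t ^ (1 - β)) with hG
  have hGm : Measurable G := measurable_setLIntegral_gaussAvg hV2 β
  have hGi : ∫⁻ x, G x = ENNReal.ofReal e := by
    rw [hE]; exact lintegral_setLIntegral_gaussAvg hV2 β
  set D : ℝ≥0∞ := ∫⁻ x in ball (0 : EuclideanSpace ℝ (Fin n)) 1,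
    ENNReal.ofReal (‖x‖ ^ (-(d + β))) with hD
  have hDtop : D < ∞ := lintegral_ball_one_rpow_norm_lt_top hn (by rw [hd]; linarith)
  set m : ℝ → ℝ≥0∞ := fun t => (∫⁻ y, V y t ^ 2) * ENNReal.ofReal (t ^ (1 + d - n)) with hm
  have hmm : Measurable m := hVm.mul (by fun_prop)
  have hH : ∫⁻ x : EuclideanSpace ℝ (Fin n),
      (∫⁻ t in Ioi ‖x‖, m t) * ENNReal.ofReal (‖x‖ ^ (-(d + β))) = ENNReal.ofReal e * D := by
    rw [lintegral_setLIntegral_Ioi_norm_mul hmm (by fun_prop), hE, ← lintegral_mul_const' _ _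
        hDtop.ne]
    refine setLIntegral_congr_fun measurableSet_Ioi fun t ht => ?_
    have ht0 : 0 < t := ht
    rw [lintegral_ball_rpow_norm _ ht0, hm, ← mul_assoc]
    congr 1
    rw [mul_assoc, ← ENNReal.ofReal_mul (by positivity), ← Real.rpow_add ht0]
    congr 3; ring
  have hne : ∀ᵐ x : EuclideanSpace ℝ (Fin n), x ≠ 0 := by
    have : Nonempty (Fin n) := ⟨⟨0, hn⟩⟩
    exact Measure.ae_ne volume 0
  have hpt : ∀ᵐ x, ENNReal.ofReal (reproConst s ^ 2 * (f x ^ 2 / ‖x‖ ^ β)) ≤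
      ENNReal.ofReal (2 / β) * G x + ENNReal.ofReal (2 * π ^ (-(n:ℝ)/2) / d) *
        ((∫⁻ t in Ioi ‖x‖, m t) * ENNReal.ofReal (‖x‖ ^ (-(d + β)))) := by
    filter_upwards [hne] with x hx
    have hxp : 0 < ‖x‖ := norm_pos_iff.2 hx
    have h1 := (ofReal_sq_le_sq_setLIntegral_gaussAvg hn hs hf hc x).trans
      (sq_setLIntegral_gaussAvg_le hV hβ hd0 hxp x)
    have b1 : ENNReal.ofReal (2 / β) = 2 * (ENNReal.ofReal (‖x‖ ^ β / β) *
        ENNReal.ofReal (‖x‖ ^ (-β))) := by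
      generalize ‖x‖ = r at hxp ⊢
      rw [← ENNReal.ofReal_ofNat, ← ENNReal.ofReal_mul (by positivity),
        ← ENNReal.ofReal_mul (by positivity), Real.rpow_neg hxp.le]
      congr 1; field_simp
    have b2 : ENNReal.ofReal (2 * π ^ (-(n:ℝ)/2) / d) * ENNReal.ofReal (‖x‖ ^ (-(d + β))) =
        2 * (ENNReal.ofReal (π ^ (-(n:ℝ)/2)) * (ENNReal.ofReal (‖x‖ ^ (-d) / d) *
          ENNReal.ofReal (‖x‖ ^ (-β)))) := by
      generalize ‖x‖ = r at hxp ⊢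
      rw [← ENNReal.ofReal_ofNat, ← ENNReal.ofReal_mul (by positivity),
        ← ENNReal.ofReal_mul (by positivity), ← ENNReal.ofReal_mul (by positivity),
        ← ENNReal.ofReal_mul (by positivity), neg_add, Real.rpow_add hxp]
      congr 1; ring
    calc ENNReal.ofReal (reproConst s ^ 2 * (f x ^ 2 / ‖x‖ ^ β))
        = ENNReal.ofReal (reproConst s ^ 2 * f x ^ 2) * ENNReal.ofReal (‖x‖ ^ (-β)) := by
          rw [← ENNReal.ofReal_mul (by positivity), Real.rpow_neg hxp.le]
          congr 1; ring
      _ ≤ _ * ENNReal.ofReal (‖x‖ ^ (-β)) := mul_le_mul' h1 le_rfl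
      _ = 2 * (ENNReal.ofReal (‖x‖ ^ β / β) * ENNReal.ofReal (‖x‖ ^ (-β))) * G x +
          2 * (ENNReal.ofReal (π ^ (-(n:ℝ)/2)) * (ENNReal.ofReal (‖x‖ ^ (-d) / d) *
            ENNReal.ofReal (‖x‖ ^ (-β)))) * ∫⁻ t in Ioi ‖x‖, m t := by ring
      _ = _ := by rw [← b1, ← b2]; ring
  have hle_int : ∫⁻ x, ENNReal.ofReal (reproConst s ^ 2 * (f x ^ 2 / ‖x‖ ^ β)) ≤
      ENNReal.ofReal (reproConst s ^ 2 * (hardyConst n s β * e)) := by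
    refine (lintegral_mono_ae hpt).trans_eq ?_
    rw [lintegral_add_left (by fun_prop), lintegral_const_mul _ hGm,
      lintegral_const_mul' _ _ ENNReal.ofReal_ne_top, hGi, hH, ← ENNReal.ofReal_toReal hDtop.ne,
      ← ENNReal.ofReal_mul (by positivity), ← ENNReal.ofReal_mul (by positivity),
      ← ENNReal.ofReal_mul (by positivity), ← ENNReal.ofReal_add (by positivity) (by positivity)]
    congr 1
    rw [hardyConst, ← hd, ← hD]
    field_simp
  have hcont := hf.continuous
  have hh0 := hardyConst_pos hs hβ hβn
  have hreal := integral_le_of_lintegral_ofReal_le (fun x => by positivity)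
    (Measurable.aestronglyMeasurable (by fun_prop)) (by positivity) hle_int
  rw [integral_const_mul] at hreal
  exact le_of_mul_le_mul_left hreal (by positivity)

end

end

/-- fractional anisotropic Sobolev / logarithmic Sobolev / Hardy trace
inequalities in terms of `∂_t u` only, for `β ∈ (0, min{n,2s})`.
(In Lean, `Real.log 0 = 0`, so `t ln t` is automatically interpreted as `0` at `t = 0`.) -/
theorem anisotropic_trace_inequalities (n : ℕ) (hn : 1 ≤ n) (s β : ℝ)
    (hs : s ∈ Set.Ioo (0:ℝ) 2) (hβ : 0 < β) (hβ' : β < min (n:ℝ) (2*s)) :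
    ∃ C : ℝ, 0 < C ∧ ∀ f : EuclideanSpace ℝ (Fin n) → ℝ,
      ContDiff ℝ (⊤ : ℕ∞) f → HasCompactSupport f →
      ((∫ x, |f x| ^ ((2*(n:ℝ))/((n:ℝ) - β))) ^ (((n:ℝ) - β)/(n:ℝ)) ≤ C * tEnergy n s β f) ∧
      ((∫ x, (f x)^2) = 1 →
        Real.exp ((β/(n:ℝ)) * ∫ x, (f x)^2 * Real.log ((f x)^2)) ≤ C * tEnergy n s β f) ∧
      ((∫ x, (f x)^2 / ‖x‖ ^ β) ≤ C * tEnergy n s β f) := by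
  obtain ⟨hs, hs2⟩ := hs
  obtain ⟨hβn, hβs⟩ := lt_min_iff.1 hβ'
  have hd : 0 < (n:ℝ) - β := sub_pos.2 hβn
  have hn0 : (0:ℝ) < n := hβ.trans hβn
  have hr := reproConst_pos hs
  have hH := hardyConst_pos hs hβ hβn
  obtain ⟨C, hC⟩ : ∃ C, C = 4 * (1 / β + π ^ (-(n:ℝ) / 2) / (n - β)) / reproConst s ^ 2 :=
    ⟨_, rfl⟩
  have hC0 : 0 < C := by rw [hC]; positivity
  refine ⟨C + hardyConst n s β, by positivity, fun f hf hc => ?_⟩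
  have he := tEnergy_nonneg n s β f
  have sobolev : (∫ x, |f x| ^ ((2*(n:ℝ))/((n:ℝ) - β))) ^ (((n:ℝ) - β)/(n:ℝ)) ≤
      (C + hardyConst n s β) * tEnergy n s β f := by
    have h := integral_rpow_le_tEnergy hn hs hs2 hβ hβn hβs hf hc
    rw [← hC] at h
    calc _ ≤ ((C * tEnergy n s β f) ^ ((n:ℝ) / (n - β))) ^ (((n:ℝ) - β)/(n:ℝ)) :=
          Real.rpow_le_rpow (integral_nonneg fun x => by positivity) h (by positivity)
      _ = C * tEnergy n s β f := by
          rw [← Real.rpow_mul (by positivity), div_mul_div_cancel₀ hd.ne', div_self hn0.ne',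
            Real.rpow_one]
      _ ≤ _ := by gcongr; linarith
  refine ⟨sobolev, fun h1 => ?_, ?_⟩
  · exact (exp_integral_mul_log_le hβ hβn hf.continuous hc h1).trans sobolev
  · refine (integral_sq_div_norm_rpow_le_tEnergy hn hs hs2 hβ hβn hβs hf hc).trans ?_
    gcongr
    linarith

end
end
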